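/- Let G be a graph with finitely many ends, each of finite vertex-degree, and let ω₁ ≠ ω₂ be two ends of G. If for every k ∈ ℕ there are k pairwise edge-disjoint double rays each converging to both ω₁ and ω₂, then there are infinitely many pairwise edge-disjoint double rays each converging to both ω₁ and ω₂. -/

import Mathlib

open SimpleGraph

variable {V : Type*}

/-- A ray in `G`: an injective sequence of vertices with consecutive vertices adjacent. -/
def IsRay (G : SimpleGraph V) (f : ℕ → V) : Prop :=
  Function.Injective f ∧ ∀ n, G.Adj (f n) (f (n + 1))

/-- A double ray in `G`: an injective two-way infinite sequence with consecutive
vertices adjacent. -/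
def IsDoubleRay (G : SimpleGraph V) (f : ℤ → V) : Prop :=
  Function.Injective f ∧ ∀ n, G.Adj (f n) (f (n + 1))

/-- The edges used by a ray. -/
def rayEdges (f : ℕ → V) : Set (Sym2 V) := {e | ∃ n, e = s(f n, f (n + 1))}

/-- The edges used by a double ray. -/
def drEdges (f : ℤ → V) : Set (Sym2 V) := {e | ∃ n : ℤ, e = s(f n, f (n + 1))}

/-- Two rays are equivalent (belong to the same end) iff no finite vertex set
separates them: for every finite `S` there are tails of both rays avoiding `S`
which are joined by a walk avoiding `S`. -/
def RayEquiv (G : SimpleGraph V) (f g : ℕ → V) : Prop :=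
  ∀ S : Finset V, ∃ a b, (∀ i, a ≤ i → f i ∉ S) ∧ (∀ j, b ≤ j → g j ∉ S) ∧
    ∃ w : G.Walk (f a) (g b), ∀ v ∈ w.support, v ∉ S

/-- The forward ray of a double ray. -/
def drFwd (f : ℤ → V) : ℕ → V := fun n => f n

/-- The backward ray of a double ray. -/
def drBwd (f : ℤ → V) : ℕ → V := fun n => f (-(n : ℤ) - 1)

/-- The end (represented by the ray `R`) has vertex-degree exactly `k`:
there are `k` pairwise vertex-disjoint rays equivalent to `R`, but not `k + 1`. -/
def EndVertexDegree (G : SimpleGraph V) (R : ℕ → V) (k : ℕ) : Prop :=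
  (∃ F : Fin k → ℕ → V, (∀ i, IsRay G (F i) ∧ RayEquiv G R (F i)) ∧
      Pairwise fun i j => Disjoint (Set.range (F i)) (Set.range (F j))) ∧
  ¬ ∃ F : Fin (k + 1) → ℕ → V, (∀ i, IsRay G (F i) ∧ RayEquiv G R (F i)) ∧
      Pairwise fun i j => Disjoint (Set.range (F i)) (Set.range (F j))

/-- The double ray `D` converges exactly to the two (distinct) ends represented by
`W₁` and `W₂`: one of its two constituent rays lies in each. -/
def ConvBoth (G : SimpleGraph V) (W₁ W₂ : ℕ → V) (D : ℤ → V) : Prop :=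
  (RayEquiv G W₁ (drFwd D) ∧ RayEquiv G W₂ (drBwd D)) ∨
  (RayEquiv G W₁ (drBwd D) ∧ RayEquiv G W₂ (drFwd D))

/-- The graph obtained from `G` by isolating the vertices in `S` and deleting the edges in `F`. -/
def offGraph (G : SimpleGraph V) (S : Set V) (F : Set (Sym2 V)) : SimpleGraph V where
  Adj u v := G.Adj u v ∧ u ∉ S ∧ v ∉ S ∧ s(u, v) ∉ F
  symm := ⟨fun _ _ h => ⟨h.1.symm, h.2.2.1, h.2.1, by rw [Sym2.eq_swap]; exact h.2.2.2⟩⟩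
  loopless := ⟨fun _ h => h.1.ne rfl⟩

lemma offGraph_mono (G : SimpleGraph V) {S S' : Set V} {F F' : Set (Sym2 V)} (hS : S ⊆ S')
    (hF : F ⊆ F') : offGraph G S' F' ≤ offGraph G S F :=
  fun _ _ h => ⟨h.1, fun h' => h.2.1 (hS h'), fun h' => h.2.2.1 (hS h'),
    fun he => h.2.2.2 (hF he)⟩

/-- The set of endpoints of a set of edges. -/
def edgeEnds (F : Set (Sym2 V)) : Set V := {v | ∃ e ∈ F, v ∈ e}

lemma edgeEnds_finite {F : Set (Sym2 V)} (hF : F.Finite) : (edgeEnds F).Finite := by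
  have : edgeEnds F = ⋃ e ∈ F, {v | v ∈ e} := by
    ext v; simp [edgeEnds]
  rw [this]
  refine hF.biUnion fun e _ => ?_
  induction e with
  | _ a b =>
    refine (Set.toFinite {a, b}).subset fun v hv => ?_
    simpa using hv

lemma offGraph_edgeEnds_le (G : SimpleGraph V) (S : Set V) (F : Set (Sym2 V)) :
    offGraph G (S ∪ edgeEnds F) ∅ ≤ offGraph G S F := fun u v h =>
  ⟨h.1, fun h' => h.2.1 (Or.inl h'), fun h' => h.2.2.1 (Or.inl h'),
    fun h' => h.2.1 (Or.inr ⟨_, h', Sym2.mem_mk_left u v⟩)⟩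

lemma reachable_offGraph_of_walk {G : SimpleGraph V} {S : Set V} {u v : V} (w : G.Walk u v)
    (hw : ∀ x ∈ w.support, x ∉ S) : (offGraph G S ∅).Reachable u v := by
  induction w with
  | nil => exact Reachable.refl _
  | cons h p ih =>
    rw [Walk.support_cons] at hw
    have h1 := ih fun x hx => hw x (List.mem_cons_of_mem _ hx)
    refine Reachable.trans (Adj.reachable ?_) h1
    exact ⟨h, hw _ (by simp), hw _ (by simp), by simp⟩

lemma exists_walk_of_reachable_offGraph {G : SimpleGraph V} {S : Set V} {F : Set (Sym2 V)}
    {u v : V} (hu : u ∉ S) (h : (offGraph G S F).Reachable u v) :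
    ∃ w : G.Walk u v, (∀ x ∈ w.support, x ∉ S) ∧ ∀ e ∈ w.edges, e ∉ F := by
  obtain ⟨w⟩ := h
  induction w with
  | nil => exact ⟨Walk.nil, by simpa using hu, by simp⟩
  | cons h p ih =>
    obtain ⟨w, hw, hF⟩ := ih h.2.2.1
    refine ⟨Walk.cons h.1 w, ?_, ?_⟩
    · intro x hx
      rw [Walk.support_cons, List.mem_cons] at hx
      rcases hx with rfl | hx
      exacts [hu, hw x hx]
    · intro e he
      rw [Walk.edges_cons, List.mem_cons] at he
      rcases he with rfl | he
      exacts [h.2.2.2, hF e he]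

lemma reachable_tail {G : SimpleGraph V} {f : ℕ → V} (hf : ∀ n, G.Adj (f n) (f (n + 1))) {a : ℕ}
    {S : Set V} {F : Set (Sym2 V)} (ha : ∀ i, a ≤ i → f i ∉ S)
    (hF : ∀ i, a ≤ i → s(f i, f (i + 1)) ∉ F) {i j : ℕ} (hi : a ≤ i) (hj : a ≤ j) :
    (offGraph G S F).Reachable (f i) (f j) := by
  have key : ∀ n, (offGraph G S F).Reachable (f a) (f (a + n)) := by
    intro n
    induction n with
    | zero => exact Reachable.refl _
    | succ n ih =>
      refine ih.trans (Adj.reachable ⟨hf _, ha _ (by omega), ha _ (by omega), hF _ (by omega)⟩)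
  obtain ⟨i, rfl⟩ := Nat.exists_eq_add_of_le hi
  obtain ⟨j, rfl⟩ := Nat.exists_eq_add_of_le hj
  exact (key i).symm.trans (key j)

lemma IsRay.exists_tail_notMem {G : SimpleGraph V} {f : ℕ → V} (hf : IsRay G f) {S : Set V}
    (hS : S.Finite) : ∃ a, ∀ i, a ≤ i → f i ∉ S := by
  have h : (f ⁻¹' S).Finite := hS.preimage hf.1.injOn
  obtain ⟨b, hb⟩ := h.bddAbove
  exact ⟨b + 1, fun i hi hm => absurd (hb hm) (by omega)⟩

lemma IsRay.mono {G H : SimpleGraph V} (h : G ≤ H) {f : ℕ → V} (hf : IsRay G f) : IsRay H f :=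
  ⟨hf.1, fun n => h (hf.2 n)⟩

lemma IsRay.tail {G : SimpleGraph V} {f : ℕ → V} (hf : IsRay G f) (a : ℕ) :
    IsRay G fun n => f (a + n) :=
  ⟨fun i j h => by have := hf.1 h; omega, fun n => hf.2 (a + n)⟩

lemma rayEdges_tail_subset (f : ℕ → V) (a : ℕ) : rayEdges (fun n => f (a + n)) ⊆ rayEdges f := by
  rintro e ⟨n, rfl⟩
  exact ⟨a + n, rfl⟩

lemma rayEdges_nonempty (f : ℕ → V) : (rayEdges f).Nonempty := ⟨_, 0, rfl⟩

lemma IsRay.edge_inj {G : SimpleGraph V} {f : ℕ → V} (hf : IsRay G f) {i j : ℕ}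
    (h : s(f i, f (i + 1)) = s(f j, f (j + 1))) : i = j := by
  rw [Sym2.eq_iff] at h
  rcases h with ⟨h, -⟩ | ⟨h, h'⟩
  · exact hf.1 h
  · have := hf.1 h
    have := hf.1 h'
    omega

lemma RayEquiv.joined {G : SimpleGraph V} {f g : ℕ → V} (h : RayEquiv G f g) {S : Set V}
    (hS : S.Finite) : ∃ a b, (∀ i, a ≤ i → f i ∉ S) ∧ (∀ j, b ≤ j → g j ∉ S) ∧
      (offGraph G S ∅).Reachable (f a) (g b) := by
  obtain ⟨a, b, ha, hb, w, hw⟩ := h hS.toFinset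
  refine ⟨a, b, by simpa using ha, by simpa using hb, reachable_offGraph_of_walk w ?_⟩
  simpa using hw

lemma rayEquiv_of_joined {G : SimpleGraph V} {f g : ℕ → V}
    (h : ∀ S : Set V, S.Finite → ∃ a b, (∀ i, a ≤ i → f i ∉ S) ∧ (∀ j, b ≤ j → g j ∉ S) ∧
      (offGraph G S ∅).Reachable (f a) (g b)) : RayEquiv G f g := by
  intro S
  obtain ⟨a, b, ha, hb, hr⟩ := h S S.finite_toSet
  obtain ⟨w, hw, -⟩ := exists_walk_of_reachable_offGraph (ha a le_rfl) hr
  exact ⟨a, b, ha, hb, w, hw⟩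

lemma RayEquiv.symm {G : SimpleGraph V} {f g : ℕ → V} (h : RayEquiv G f g) : RayEquiv G g f :=
  rayEquiv_of_joined fun _ hS =>
    let ⟨a, b, ha, hb, hr⟩ := h.joined hS
    ⟨b, a, hb, ha, hr.symm⟩

lemma RayEquiv.trans {G : SimpleGraph V} {f g k : ℕ → V} (hg : ∀ n, G.Adj (g n) (g (n + 1)))
    (h : RayEquiv G f g) (h' : RayEquiv G g k) : RayEquiv G f k :=
  rayEquiv_of_joined fun S hS => by
    obtain ⟨a, b, ha, hb, hr⟩ := h.joined hS
    obtain ⟨c, d, hc, hd, hr'⟩ := h'.joined hS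
    refine ⟨a, d, ha, hd, hr.trans (Reachable.trans ?_ hr')⟩
    rcases le_total b c with hbc | hbc
    · exact reachable_tail hg hb (by simp) le_rfl hbc
    · exact reachable_tail hg hc (by simp) hbc le_rfl

/-- Two rays that share infinitely many vertices, or a common tail, belong to the same end. -/
lemma rayEquiv_of_frequently_meet {G : SimpleGraph V} {f g : ℕ → V} (hf : IsRay G f)
    (hg : IsRay G g) (h : ∀ n, ∃ i ≥ n, ∃ j ≥ n, f i = g j) : RayEquiv G f g :=
  rayEquiv_of_joined fun S hS => by
    obtain ⟨a, ha⟩ := hf.exists_tail_notMem hS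
    obtain ⟨b, hb⟩ := hg.exists_tail_notMem hS
    obtain ⟨i, hi, j, hj, hij⟩ := h (max a b)
    refine ⟨i, j, fun k hk => ha k (by omega), fun k hk => hb k (by omega), ?_⟩
    rw [hij]

lemma rayEquiv_of_common_tail {G : SimpleGraph V} {f g : ℕ → V} (hf : IsRay G f)
    (hg : IsRay G g) {a b : ℕ} (h : ∀ n, f (a + n) = g (b + n)) : RayEquiv G f g :=
  rayEquiv_of_frequently_meet hf hg fun n => ⟨a + n, by omega, b + n, by omega, h n⟩
open Classical in
lemma card_filter_not_disjoint_le {ι α : Type*} {s : Finset ι} {E : ι → Set α}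
    (hE : (s : Set ι).PairwiseDisjoint E) {F : Set α} (hF : F.Finite) :
    (s.filter fun i => ¬ Disjoint (E i) F).card ≤ F.ncard := by
  have h : ∀ i ∈ s.filter (fun i => ¬ Disjoint (E i) F), ∃ e, e ∈ E i ∧ e ∈ F := by
    intro i hi
    exact Set.not_disjoint_iff.1 (Finset.mem_filter.1 hi).2
  rcases (s.filter fun i => ¬ Disjoint (E i) F).eq_empty_or_nonempty with h0 | ⟨i, hi⟩
  · simp [h0]
  have : Nonempty α := ⟨(h i hi).choose⟩
  choose! g hg using h
  rw [Set.ncard_eq_toFinset_card F hF]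
  refine Finset.card_le_card_of_injOn g (fun i hi => by simpa using (hg i hi).2) ?_
  intro i hi j hj hij
  by_contra hne
  have hd := hE (Finset.mem_filter.1 hi).1 (Finset.mem_filter.1 hj).1 hne
  exact Set.disjoint_left.1 hd (hg i hi).1 (hij ▸ (hg j hj).1)

open Classical in
lemma card_image_of_rayEdges_subset {s : Finset (ℕ → V)}
    (hs : (s : Set (ℕ → V)).PairwiseDisjoint rayEdges) {φ : (ℕ → V) → ℕ → V}
    (hφ : ∀ f ∈ s, rayEdges (φ f) ⊆ rayEdges f) :
    (s.image φ).card = s.card ∧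
      ((s.image φ : Finset _) : Set (ℕ → V)).PairwiseDisjoint rayEdges := by
  constructor
  · refine Finset.card_image_of_injOn fun f hf g hg hfg => ?_
    by_contra hne
    obtain ⟨e, he⟩ := rayEdges_nonempty (φ f)
    exact Set.disjoint_left.1 (hs hf hg hne) (hφ f hf he) (hφ g hg (hfg ▸ he))
  · intro f' hf' g' hg' hne
    obtain ⟨f, hf, rfl⟩ := Finset.mem_image.1 hf'
    obtain ⟨g, hg, rfl⟩ := Finset.mem_image.1 hg'
    have : f ≠ g := fun h => hne (h ▸ rfl)
    exact (hs hf hg this).mono (hφ f hf) (hφ g hg)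

/-- There are arbitrarily large finite families of pairwise edge-disjoint rays of `K` that start
at `x` and avoid `Y`. -/
def Fan (K : SimpleGraph V) (Y : Set V) (x : V) : Prop :=
  ∀ k : ℕ, ∃ s : Finset (ℕ → V), k ≤ s.card ∧
    (∀ f ∈ s, IsRay K f ∧ f 0 = x ∧ ∀ n, f n ∉ Y) ∧ (s : Set (ℕ → V)).PairwiseDisjoint rayEdges

lemma Fan.mono {K : SimpleGraph V} {Y Y' : Set V} {x : V} (h : Fan K Y x) (hY : Y' ⊆ Y) :
    Fan K Y' x := fun k =>
  let ⟨s, hk, hs, hd⟩ := h k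
  ⟨s, hk, fun f hf => ⟨(hs f hf).1, (hs f hf).2.1, fun n hn => (hs f hf).2.2 n (hY hn)⟩, hd⟩

lemma Fan.exists_avoiding {K : SimpleGraph V} {Y : Set V} {x : V} (h : Fan K Y x)
    {F : Set (Sym2 V)} (hF : F.Finite) (k : ℕ) : ∃ s : Finset (ℕ → V), k ≤ s.card ∧
    (∀ f ∈ s, IsRay K f ∧ f 0 = x ∧ (∀ n, f n ∉ Y) ∧ Disjoint (rayEdges f) F) ∧
      (s : Set (ℕ → V)).PairwiseDisjoint rayEdges := by
  classical
  obtain ⟨s, hk, hs, hd⟩ := h (k + F.ncard)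
  have h1 := card_filter_not_disjoint_le hd hF
  have h2 := Finset.card_filter_add_card_filter_not (s := s) (fun f => Disjoint (rayEdges f) F)
  refine ⟨s.filter fun f => Disjoint (rayEdges f) F, by omega, ?_, ?_⟩
  · intro f hf
    obtain ⟨hf, hf'⟩ := Finset.mem_filter.1 hf
    exact ⟨(hs f hf).1, (hs f hf).2.1, (hs f hf).2.2, hf'⟩
  · exact hd.subset (Finset.coe_subset.2 (Finset.filter_subset _ _))

lemma Fan.exists_ray {K : SimpleGraph V} {Y : Set V} {x : V} (h : Fan K Y x)
    {F : Set (Sym2 V)} (hF : F.Finite) :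
    ∃ f, IsRay K f ∧ f 0 = x ∧ (∀ n, f n ∉ Y) ∧ Disjoint (rayEdges f) F := by
  obtain ⟨s, hk, hs, -⟩ := h.exists_avoiding hF 1
  obtain ⟨f, hf⟩ := Finset.card_pos.1 hk
  exact ⟨f, hs f hf⟩

lemma Fan.notMem {K : SimpleGraph V} {Y : Set V} {x : V} (h : Fan K Y x) : x ∉ Y := by
  obtain ⟨f, -, rfl, hf, -⟩ := h.exists_ray Set.finite_empty
  exact hf 0

/-- If most rays of a large fan at `x` pass through `u`, then their tails form a fan at `u`. -/
lemma Fan.insert_or {K : SimpleGraph V} {Y : Set V} {x u : V} (h : Fan K Y x) (hux : u ≠ x) :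
    Fan K (insert u Y) x ∨ Fan K (insert x Y) u := by
  classical
  by_contra! hcon
  simp only [Fan, not_forall] at hcon
  obtain ⟨⟨k, hk⟩, l, hl⟩ := hcon
  obtain ⟨s, hs, hr, hd⟩ := h (k + l)
  have h2 := Finset.card_filter_add_card_filter_not (s := s) (fun f => u ∉ Set.range f)
  by_cases hc : k ≤ (s.filter fun f => u ∉ Set.range f).card
  · refine hk ⟨_, hc, ?_, hd.subset (Finset.coe_subset.2 (Finset.filter_subset _ _))⟩
    intro f hf
    obtain ⟨hf, hf'⟩ := Finset.mem_filter.1 hf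
    refine ⟨(hr f hf).1, (hr f hf).2.1, fun n hn => ?_⟩
    rcases hn with hn | hn
    exacts [hf' ⟨n, hn⟩, (hr f hf).2.2 n hn]
  · have hpos : ∀ f : ℕ → V, ∃ n, u ∈ Set.range f → f n = u := by
      intro f
      by_cases hu : u ∈ Set.range f
      · obtain ⟨n, hn⟩ := hu
        exact ⟨n, fun _ => hn⟩
      · exact ⟨0, fun h => absurd h hu⟩
    choose pos hpos using hpos
    set t := s.filter fun f => ¬ u ∉ Set.range f with ht
    obtain ⟨h3, h4⟩ := card_image_of_rayEdges_subset (s := t)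
      (hd.subset (Finset.coe_subset.2 (Finset.filter_subset _ _)))
      (φ := fun f n => f (pos f + n)) fun f _ => rayEdges_tail_subset f _
    refine hl ⟨_, by omega, ?_, h4⟩
    intro f' hf'
    obtain ⟨f, hf, rfl⟩ := Finset.mem_image.1 hf'
    obtain ⟨hf, hfu⟩ := Finset.mem_filter.1 hf
    have hp := hpos f (not_not.1 hfu)
    refine ⟨(hr f hf).1.tail _, hp, fun n hn => ?_⟩
    rcases hn with hn | hn
    · have h5 : f (pos f + n) = f 0 := hn.trans (hr f hf).2.1.symm
      have h6 := (hr f hf).1.1 h5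
      have h7 : pos f = 0 := by omega
      rw [h7, (hr f hf).2.1] at hp
      exact hux hp.symm
    · exact (hr f hf).2.2 _ hn

/-- Large edge-disjoint families of rays starting in a finite set contain a fan. -/
lemma exists_fan_of_finite_starts {K : SimpleGraph V} {S : Set V} (hS : S.Finite)
    (h : ∀ k : ℕ, ∃ s : Finset (ℕ → V), k ≤ s.card ∧ (∀ f ∈ s, IsRay K f ∧ f 0 ∈ S) ∧
      (s : Set (ℕ → V)).PairwiseDisjoint rayEdges) : ∃ x, Fan K ∅ x := by
  classical
  by_contra! hcon
  simp only [Fan, not_forall] at hcon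
  choose b hb using hcon
  let B := ∑ x ∈ hS.toFinset, b x
  obtain ⟨s, hs, hr, hd⟩ := h (hS.toFinset.card * B + 1)
  obtain ⟨x, hx, hlt⟩ := Finset.exists_lt_card_fiber_of_mul_lt_card_of_maps_to
    (s := s) (t := hS.toFinset) (f := fun f => f 0) (n := B)
    (fun f hf => by simpa using (hr f hf).2) (by omega)
  have hB : b x ≤ B := Finset.single_le_sum (f := b) (fun _ _ => Nat.zero_le _) hx
  refine hb x ⟨_, hB.trans hlt.le, ?_, hd.subset (Finset.coe_subset.2 (Finset.filter_subset _ _))⟩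
  intro f hf
  obtain ⟨hf, hf'⟩ := Finset.mem_filter.1 hf
  exact ⟨(hr f hf).1, hf', by simp⟩
section Linkage

variable {ι κ α : Type*}

/-- In the state `c`, the current edge `p i (c i)` of the path `p i` lies on some `q j`, and no path
has met `q j` at a later edge. -/
def IsSettled (p : ι → ℕ → α) (q : κ → ℕ → α) (c : ι → ℕ) (i : ι) (j : κ) (b : ℕ) : Prop :=
  p i (c i) = q j b ∧ ∀ i' n b', n ≤ c i' → p i' n = q j b' → b' ≤ b

open Classical in
/-- The process moving every path that is not settled forward by one edge. -/
noncomputable def linkState (p : ι → ℕ → α) (q : κ → ℕ → α) : ℕ → ι → ℕ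
  | 0 => fun _ => 0
  | t + 1 => fun i => if ∃ j b, IsSettled p q (linkState p q t) i j b then linkState p q t i
      else linkState p q t i + 1

lemma linkState_mono (p : ι → ℕ → α) (q : κ → ℕ → α) (i : ι) :
    Monotone fun t => linkState p q t i := by
  refine monotone_nat_of_le_succ fun t => ?_
  simp only [linkState]
  split_ifs <;> omega

variable [Finite ι] {p : ι → ℕ → α} {q : κ → ℕ → α}

lemma exists_isSettled_of_meets
    (hq : ∀ j j' n n', q j n = q j' n' → j = j' ∧ n = n') (t : ℕ) (j : κ)
    (hj : ∃ i n b, n ≤ linkState p q t i ∧ p i n = q j b) :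
    ∃ i b, IsSettled p q (linkState p q t) i j b := by
  have hfin : {b | ∃ i n, n ≤ linkState p q t i ∧ p i n = q j b}.Finite := by
    have h1 : (Set.univ : Set ((i : ι) × Fin (linkState p q t i + 1))).Finite := Set.finite_univ
    have h2 := (h1.image fun x => p x.1 x.2).preimage (f := q j)
      (fun a _ b _ h => (hq _ _ _ _ h).2)
    refine h2.subset ?_
    rintro b ⟨i, n, hn, hb⟩
    exact ⟨⟨i, ⟨n, by omega⟩⟩, trivial, hb⟩
  obtain ⟨b, ⟨i, n, hn, hb⟩, hmax⟩ := hfin.exists_maximal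
    (let ⟨i, n, b, h⟩ := hj; ⟨b, i, n, h⟩)
  have hmax' : ∀ i' n' b', n' ≤ linkState p q t i' → p i' n' = q j b' → b' ≤ b := by
    intro i' n' b' h1 h2
    by_contra hlt
    exact hlt (hmax ⟨i', n', h1, h2⟩ (by omega))
  rcases hn.eq_or_lt with rfl | hn
  · exact ⟨i, b, hb, hmax'⟩
  exfalso
  clear hj hmax hfin
  induction t with
  | zero => simp [linkState] at hn
  | succ t ih =>
    have hle : ∀ i', linkState p q t i' ≤ linkState p q (t + 1) i' :=
      fun i' => linkState_mono p q i' (Nat.le_succ t)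
    have hmaxt : ∀ i' n' b', n' ≤ linkState p q t i' → p i' n' = q j b' → b' ≤ b :=
      fun i' n' b' h1 h2 => hmax' i' n' b' (h1.trans (hle i')) h2
    have hn' : n ≤ linkState p q t i := by
      simp only [linkState] at hn
      split_ifs at hn <;> omega
    rcases hn'.eq_or_lt with rfl | hn'
    · simp only [linkState] at hn
      split_ifs at hn with h
      · omega
      · exact h ⟨j, b, hb, hmaxt⟩
    · exact ih hn'.le hmaxt hn'

/-- A linkage lemma for finitely many one-way infinite paths `p i`, given by their edge sequences:
each of them can either be followed forever or left for the rest of some `q j`, in such a way that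
the resulting paths are disjoint and one more of the `q j` remains untouched. -/
lemma exists_linkage [Finite κ] (hcard : Nat.card ι < Nat.card κ)
    (hp : ∀ i i' n n', p i n = p i' n' → i = i' ∧ n = n')
    (hq : ∀ j j' n n', q j n = q j' n' → j = j' ∧ n = n') :
    ∃ halt : ι → Option (ℕ × κ × ℕ),
      (∀ i, ∀ x ∈ halt i, p i x.1 = q x.2.1 x.2.2) ∧
      (∀ i, ∀ x ∈ halt i, ∀ i' n b, (∀ y ∈ halt i', n < y.1) → p i' n = q x.2.1 b → b < x.2.2) ∧
      (∀ i i', i ≠ i' → ∀ x ∈ halt i, ∀ y ∈ halt i', x.2.1 ≠ y.2.1) ∧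
      ∃ j₀, (∀ i n b, (∀ y ∈ halt i, n < y.1) → p i n ≠ q j₀ b) ∧
        ∀ i, ∀ x ∈ halt i, x.2.1 ≠ j₀ := by
  classical
  have hmono := linkState_mono p q
  set c := linkState p q with hc
  have hlim : ∀ i, ∃ o : Option (ℕ × κ × ℕ),
      (∀ x ∈ o, ∃ t, ∀ s, t ≤ s → c s i = x.1 ∧ IsSettled p q (c s) i x.2.1 x.2.2) ∧
      ∀ n, (∀ x ∈ o, n < x.1) → ∃ t, n ≤ c t i := by
    intro i
    by_cases hst : ∃ t, ∀ s, t ≤ s → c s i = c t i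
    · obtain ⟨t, ht⟩ := hst
      have hset : ∀ s, t ≤ s → ∃ j b, IsSettled p q (c s) i j b := by
        intro s hs
        by_contra hcon
        have h1 : c (s + 1) i = c s i + 1 := by
          rw [hc]; simp only [linkState]; rw [if_neg (by rwa [hc] at hcon)]
        have h2 := ht s hs
        have h3 := ht (s + 1) (by omega)
        omega
      obtain ⟨j, b, hjb⟩ := hset t le_rfl
      refine ⟨some (c t i, j, b), ?_, ?_⟩
      · rintro x hx
        obtain rfl := Option.some.inj hx
        refine ⟨t, fun s hs => ⟨ht s hs, ?_⟩⟩
        obtain ⟨j', b', h'⟩ := hset s hs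
        have h3 := h'.1
        rw [ht s hs, hjb.1] at h3
        obtain ⟨rfl, rfl⟩ := hq _ _ _ _ h3
        exact h'
      · intro n hn
        exact ⟨t, (hn _ rfl).le⟩
    · push Not at hst
      refine ⟨none, by simp, fun n hn => ?_⟩
      clear hn
      induction n with
      | zero => exact ⟨0, Nat.zero_le _⟩
      | succ n ih =>
        obtain ⟨t, ht⟩ := ih
        obtain ⟨s, hs, hne⟩ := hst t
        have : c t i ≤ c s i := hmono i hs
        exact ⟨s, by omega⟩
  choose halt hhalt hfull using hlim
  have huse : ∀ i n, (∀ y ∈ halt i, n < y.1) → ∃ t, ∀ s, t ≤ s → n ≤ c s i := by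
    intro i n hn
    obtain ⟨t, ht⟩ := hfull i n hn
    exact ⟨t, fun s hs => ht.trans (hmono i hs)⟩
  have hunt : ∃ j₀, ∀ t i n b, n ≤ c t i → p i n ≠ q j₀ b := by
    by_contra! hcon
    choose t i n b hle heq using hcon
    obtain ⟨T, hT⟩ := (Set.finite_range t).bddAbove
    have h1 : ∀ j, ∃ i b, IsSettled p q (c T) i j b := fun j =>
      exists_isSettled_of_meets hq T j
        ⟨i j, n j, b j, (hle j).trans (hmono (i j) (hT ⟨j, rfl⟩)), heq j⟩
    choose g b' hg using h1
    have hginj : Function.Injective g := by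
      intro j j' hjj
      have h2 := (hg j).1
      have h3 := (hg j').1
      rw [hjj, h3] at h2
      exact (hq _ _ _ _ h2).1.symm
    exact absurd (Nat.card_le_card_of_injective g hginj) (by omega)
  have hpq : ∀ i, ∀ x ∈ halt i, p i x.1 = q x.2.1 x.2.2 := by
    intro i x hx
    obtain ⟨t, ht⟩ := hhalt i x hx
    have h1 := (ht t le_rfl).2.1
    rwa [(ht t le_rfl).1] at h1
  refine ⟨halt, hpq, ?_, ?_, ?_⟩
  · intro i x hx i' n b hn hb
    obtain ⟨t, ht⟩ := hhalt i x hx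
    obtain ⟨t', ht'⟩ := huse i' n hn
    have h1 := (ht (max t t') (le_max_left _ _)).2.2 i' n b (ht' _ (le_max_right _ _)) hb
    refine lt_of_le_of_ne h1 fun hbx => ?_
    rw [hbx, ← hpq i x hx] at hb
    obtain ⟨rfl, rfl⟩ := hp _ _ _ _ hb
    exact lt_irrefl _ (hn x hx)
  · intro i i' hne x hx y hy hxy
    obtain ⟨t, ht⟩ := hhalt i x hx
    obtain ⟨t', ht'⟩ := hhalt i' y hy
    obtain ⟨h1, h2⟩ := ht (max t t') (le_max_left _ _)
    obtain ⟨h3, h4⟩ := ht' (max t t') (le_max_right _ _)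
    have h5 := h2.2 i' _ y.2.2 le_rfl (by rw [hxy]; exact h4.1)
    have h6 := h4.2 i _ x.2.2 le_rfl (by rw [← hxy]; exact h2.1)
    have h7 : x.2.2 = y.2.2 := le_antisymm h6 h5
    have h8 := hpq i x hx
    rw [hxy, h7, ← hpq i' y hy] at h8
    exact hne (hp _ _ _ _ h8).1
  · obtain ⟨j₀, hj₀⟩ := hunt
    refine ⟨j₀, ?_, ?_⟩
    · intro i n b hn
      obtain ⟨t, ht⟩ := huse i n hn
      exact hj₀ t i n b (ht t le_rfl)
    · rintro i x hx rfl
      obtain ⟨t, ht⟩ := hhalt i x hx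
      exact hj₀ t i _ _ le_rfl (ht t le_rfl).2.1

end Linkage
/-- If finitely many edge-disjoint paths starting at `x` can be extended again and again, one at a
time, then in the limit they yield infinitely many edge-disjoint rays. The path with index `i`
consists of the first `m i` edges of `P i`. -/
lemma exists_rays_of_extend {K : SimpleGraph V} {x : V} (Inv : (ℕ → ℕ → V) → (ℕ → ℕ) → Prop)
    (h0 : ∃ P m, Inv P m)
    (hpath : ∀ P m, Inv P m → ∀ i, P i 0 = x ∧ (∀ j < m i, K.Adj (P i j) (P i (j + 1))) ∧
      Set.InjOn (P i) (Set.Iic (m i)))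
    (hdisj : ∀ P m, Inv P m → ∀ i i', i ≠ i' → ∀ j < m i, ∀ j' < m i',
      s(P i j, P i (j + 1)) ≠ s(P i' j', P i' (j' + 1)))
    (hext : ∀ P m, Inv P m → ∀ i, ∃ P' m', Inv P' m' ∧
      (∀ k, m k ≤ m' k ∧ ∀ j ≤ m k, P' k j = P k j) ∧ m i < m' i) :
    ∃ A : ℕ → ℕ → V, (∀ i, IsRay K (A i) ∧ A i 0 = x) ∧
      Pairwise fun i j => Disjoint (rayEdges (A i)) (rayEdges (A j)) := by
  let σ := {s : (ℕ → ℕ → V) × (ℕ → ℕ) // Inv s.1 s.2}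
  have hnext : ∀ (s : σ) (i : ℕ), ∃ s' : σ,
      (∀ k, s.1.2 k ≤ s'.1.2 k ∧ ∀ j ≤ s.1.2 k, s'.1.1 k j = s.1.1 k j) ∧ s.1.2 i < s'.1.2 i := by
    intro s i
    obtain ⟨P', m', h, h'⟩ := hext s.1.1 s.1.2 s.2 i
    exact ⟨⟨(P', m'), h⟩, h'⟩
  choose next hnext hlt using hnext
  obtain ⟨P0, m0, hP0⟩ := h0
  let st : ℕ → σ := fun t => Nat.rec ⟨(P0, m0), hP0⟩ (fun t s => next s t.unpair.1) t
  have hst : ∀ t, st (t + 1) = next (st t) t.unpair.1 := fun t => rfl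
  have hstep : ∀ t u, t ≤ u → ∀ k, (st t).1.2 k ≤ (st u).1.2 k ∧
      ∀ j ≤ (st t).1.2 k, (st u).1.1 k j = (st t).1.1 k j := by
    intro t u htu
    induction u, htu using Nat.le_induction with
    | base => exact fun k => ⟨le_rfl, fun _ _ => rfl⟩
    | succ u htu ih =>
      intro k
      obtain ⟨h1, h2⟩ := ih k
      obtain ⟨h3, h4⟩ := hnext (st u) u.unpair.1 k
      rw [← hst] at h3 h4
      exact ⟨h1.trans h3, fun j hj => (h4 j (hj.trans h1)).trans (h2 j hj)⟩
  have hunb : ∀ i n, ∃ t, n ≤ (st t).1.2 i := by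
    intro i n
    induction n with
    | zero => exact ⟨0, Nat.zero_le _⟩
    | succ n ih =>
      obtain ⟨t, ht⟩ := ih
      have h1 := (hstep t (Nat.pair i t) (Nat.right_le_pair i t) i).1
      have h2 := hlt (st (Nat.pair i t)) (Nat.pair i t).unpair.1
      rw [← hst, Nat.unpair_pair] at h2
      exact ⟨Nat.pair i t + 1, by simp only at h2; omega⟩
  choose T hT using hunb
  let A : ℕ → ℕ → V := fun i n => (st (T i n)).1.1 i n
  have hA : ∀ t i n, n ≤ (st t).1.2 i → (st t).1.1 i n = A i n := by
    intro t i n hn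
    have h1 := (hstep t (max t (T i n)) (le_max_left _ _) i).2 n hn
    have h2 := (hstep (T i n) (max t (T i n)) (le_max_right _ _) i).2 n (hT i n)
    rw [← h1, h2]
  have hA' : ∀ i N, ∃ t, ∀ u, t ≤ u → N ≤ (st u).1.2 i ∧ ∀ n ≤ N, (st u).1.1 i n = A i n := by
    intro i N
    refine ⟨T i N, fun u hu => ?_⟩
    have h1 := (hT i N).trans (hstep _ _ hu i).1
    exact ⟨h1, fun n hn => hA u i n (hn.trans h1)⟩
  refine ⟨A, fun i => ⟨⟨?_, ?_⟩, ?_⟩, ?_⟩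
  · intro a b hab
    obtain ⟨t, ht⟩ := hA' i (max a b)
    obtain ⟨h1, h2⟩ := ht t le_rfl
    refine (hpath _ _ (st t).2 i).2.2 (Set.mem_Iic.2 ((le_max_left a b).trans h1))
      (Set.mem_Iic.2 ((le_max_right a b).trans h1)) ?_
    rw [h2 a (le_max_left _ _), h2 b (le_max_right _ _), hab]
  · intro n
    obtain ⟨t, ht⟩ := hA' i (n + 1)
    obtain ⟨h1, h2⟩ := ht t le_rfl
    rw [← h2 n (by omega), ← h2 (n + 1) le_rfl]
    exact (hpath _ _ (st t).2 i).2.1 n (by omega)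
  · exact (hpath _ _ (st _).2 i).1
  · intro i i' hne
    rw [Set.disjoint_left]
    rintro e ⟨n, rfl⟩ ⟨n', hn'⟩
    obtain ⟨t, ht⟩ := hA' i (n + 1)
    obtain ⟨t', ht'⟩ := hA' i' (n' + 1)
    obtain ⟨h1, h2⟩ := ht (max t t') (le_max_left _ _)
    obtain ⟨h1', h2'⟩ := ht' (max t t') (le_max_right _ _)
    refine hdisj _ _ (st (max t t')).2 i i' hne n (by omega) n' (by omega) ?_
    rw [h2 n (by omega), h2 (n + 1) le_rfl, h2' n' (by omega), h2' (n' + 1) le_rfl, hn']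

/-- Follow the ray `P` up to some vertex not after `P p`, then the ray `Q` from some vertex not
before `Q q`. -/
lemma exists_glue {K : SimpleGraph V} {P Q : ℕ → V} (hP : IsRay K P) (hQ : IsRay K Q) {p q : ℕ}
    (h : P p = Q q) : ∃ R p' q', IsRay K R ∧ p' ≤ p ∧ q ≤ q' ∧ P p' = Q q' ∧
      (∀ n ≤ p', R n = P n) ∧ ∀ n, R (p' + n) = Q (q' + n) := by
  classical
  have hex : ∃ p', ∃ q', q ≤ q' ∧ P p' = Q q' := ⟨p, q, le_rfl, h⟩
  obtain ⟨q', hq', hpq⟩ := Nat.find_spec hex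
  set p' := Nat.find hex with hp'
  have hmin : ∀ m < p', ∀ n ≥ q, P m ≠ Q n := fun m hm n hn heq =>
    Nat.find_min hex hm ⟨n, hn, heq⟩
  let R : ℕ → V := fun n => if n ≤ p' then P n else Q (q' + (n - p'))
  have hR1 : ∀ n ≤ p', R n = P n := fun n hn => if_pos hn
  have hR2 : ∀ n, R (p' + n) = Q (q' + n) := by
    intro n
    rcases Nat.eq_zero_or_pos n with rfl | hn
    · simpa [R] using hpq
    · simp only [R]
      rw [if_neg (by omega)]
      congr 1
      omega
  refine ⟨R, p', q', ⟨?_, ?_⟩, Nat.find_min' hex ⟨q, le_rfl, h⟩, hq', hpq, hR1, hR2⟩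
  · have aux : ∀ a b, a < b → R a ≠ R b := by
      intro a b hab heq
      rcases le_or_gt p' a with ha | ha
      · obtain ⟨a, rfl⟩ := Nat.exists_eq_add_of_le ha
        obtain ⟨b, rfl⟩ := Nat.exists_eq_add_of_le (ha.trans hab.le)
        rw [hR2, hR2] at heq
        have := hQ.1 heq
        omega
      rcases le_or_gt p' b with hb | hb
      · obtain ⟨b, rfl⟩ := Nat.exists_eq_add_of_le hb
        rw [hR1 a ha.le, hR2] at heq
        exact hmin a ha _ (by omega) heq
      · rw [hR1 a ha.le, hR1 b hb.le] at heq
        have := hP.1 heq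
        omega
    intro a b heq
    rcases lt_trichotomy a b with hab | hab | hab
    exacts [absurd heq (aux a b hab), hab, absurd heq.symm (aux b a hab)]
  · intro n
    rcases lt_or_ge n p' with hn | hn
    · rw [hR1 n hn.le, hR1 (n + 1) hn]
      exact hP.2 n
    · obtain ⟨n, rfl⟩ := Nat.exists_eq_add_of_le hn
      rw [add_assoc, hR2, hR2]
      exact hQ.2 _

lemma Fan.union_of_forall_not {K : SimpleGraph V} {Y X : Set V} {x : V} (h : Fan K Y x)
    (hX : X.Finite) (hstuck : ∀ u, ¬ Fan K (insert x Y) u) : Fan K (Y ∪ (X \ {x})) x := by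
  induction X, hX using Set.Finite.induction_on with
  | empty => simpa using h
  | @insert u X _ _ ih =>
    by_cases hu : u = x
    · refine ih.mono ?_
      rintro v (hv | ⟨rfl | hv, hvx⟩)
      exacts [Or.inl hv, absurd hu hvx, Or.inr ⟨hv, hvx⟩]
    · rcases ih.insert_or hu with h' | h'
      · refine h'.mono ?_
        rintro v (hv | ⟨rfl | hv, hvx⟩)
        exacts [Or.inr (Or.inl hv), Or.inl rfl, Or.inr (Or.inr ⟨hv, hvx⟩)]
      · exact absurd (h'.mono (Set.insert_subset_insert Set.subset_union_left)) (hstuck u)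

/-- The extension step in the construction of infinitely many edge-disjoint rays at `x`: given
finitely many rays, of which we want to keep an initial segment each, one more can be added. -/
lemma exists_add_ray {K : SimpleGraph V} {Y : Set V} {x : V} (hx : Fan K Y x)
    (hstuck : ∀ u, ¬ Fan K (insert x Y) u) (J : Finset ℕ) (P : ℕ → ℕ → V) (m : ℕ → ℕ)
    (hP : ∀ i ∈ J, IsRay K (P i) ∧ P i 0 = x ∧ 1 ≤ m i)
    (hd : ∀ i ∈ J, ∀ i' ∈ J, i ≠ i' → Disjoint (rayEdges (P i)) (rayEdges (P i'))) :
    ∃ (R : ℕ → ℕ → V) (Q : ℕ → V), IsRay K Q ∧ Q 0 = x ∧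
      (∀ i ∈ J, IsRay K (R i) ∧ (∀ n ≤ m i, R i n = P i n) ∧
        Disjoint (rayEdges (R i)) (rayEdges Q)) ∧
      ∀ i ∈ J, ∀ i' ∈ J, i ≠ i' → Disjoint (rayEdges (R i)) (rayEdges (R i')) := by
  classical
  set X : Set V := ⋃ i ∈ J, P i '' Set.Iic (m i) with hX
  have hXfin : X.Finite := J.finite_toSet.biUnion fun i _ => (Set.finite_Iic _).image _
  set F : Set (Sym2 V) := ⋃ i ∈ J, (fun n => s(P i n, P i (n + 1))) '' Set.Iic (m i) with hF
  have hFfin : F.Finite := J.finite_toSet.biUnion fun i _ => (Set.finite_Iic _).image _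
  obtain ⟨s, hs, hr, hsd⟩ := (hx.union_of_forall_not hXfin hstuck).exists_avoiding hFfin
    (J.card + 1)
  have hmemX : ∀ i ∈ J, ∀ n ≤ m i, P i n ∈ X := fun i hi n hn =>
    Set.mem_biUnion hi ⟨n, hn, rfl⟩
  have hmemF : ∀ i ∈ J, ∀ n ≤ m i, s(P i n, P i (n + 1)) ∈ F := fun i hi n hn =>
    Set.mem_biUnion hi ⟨n, hn, rfl⟩
  let p : J → ℕ → Sym2 V := fun i n => s(P i (m i + n), P i (m i + n + 1))
  let q : s → ℕ → Sym2 V := fun f n => s(f.1 n, f.1 (n + 1))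
  have hp : ∀ i i' n n', p i n = p i' n' → i = i' ∧ n = n' := by
    intro i i' n n' h
    have hii : i = i' := by
      by_contra hne
      refine Set.disjoint_left.1 (hd i i.2 i' i'.2 fun h => hne (Subtype.ext h)) ⟨_, rfl⟩ ⟨_, h⟩
    subst hii
    have := (hP i i.2).1.edge_inj h
    exact ⟨rfl, by omega⟩
  have hq : ∀ j j' n n', q j n = q j' n' → j = j' ∧ n = n' := by
    intro i i' n n' h
    have hii : i = i' := by
      by_contra hne
      refine Set.disjoint_left.1 (hsd i.2 i'.2 fun h => hne (Subtype.ext h)) ⟨_, rfl⟩ ⟨_, h⟩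
    subst hii
    exact ⟨rfl, (hr i i.2).1.edge_inj h⟩
  obtain ⟨halt, h1, h2, h3, j₀, h4, h5⟩ := exists_linkage (ι := J) (κ := s)
    (by simp only [Nat.card_eq_fintype_card, Fintype.card_coe]; omega) hp hq
  let E : J → Set (Sym2 V) := fun i => {e | (∃ n < m i, e = s(P i n, P i (n + 1))) ∨
    (∃ n, (∀ y ∈ halt i, n < y.1) ∧ e = p i n) ∨ ∃ y ∈ halt i, ∃ b ≥ y.2.2, e = q y.2.1 b}
  have hR : ∀ i : J, ∃ R, IsRay K R ∧ (∀ n ≤ m i, R n = P i n) ∧ rayEdges R ⊆ E i := by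
    intro i
    obtain ⟨hPi, hPx, hm⟩ := hP i i.2
    rcases hst : halt i with _ | ⟨c, f, b⟩
    · refine ⟨P i, hPi, fun _ _ => rfl, ?_⟩
      rintro e ⟨n, rfl⟩
      rcases lt_or_ge n (m i) with hn | hn
      · exact Or.inl ⟨n, hn, rfl⟩
      · obtain ⟨n, rfl⟩ := Nat.exists_eq_add_of_le hn
        exact Or.inr (Or.inl ⟨n, by simp [hst], rfl⟩)
    · obtain ⟨hf, hfx, hfY, hfF⟩ := hr f f.2
      have hpq : p i c = q f b := h1 i (c, f, b) hst
      have hend : ∃ b' ≥ b, P i (m i + c) = f.1 b' := by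
        have : P i (m i + c) ∈ q f b := hpq ▸ Sym2.mem_mk_left _ _
        rcases Sym2.mem_iff.1 this with h | h
        exacts [⟨b, le_rfl, h⟩, ⟨b + 1, by omega, h⟩]
      obtain ⟨b', hb', hbP⟩ := hend
      obtain ⟨R, p', q', hR, hp', hq', hpq', hR1, hR2⟩ := exists_glue hPi hf hbP
      have hb0 : b' ≠ 0 := by
        rintro rfl
        rw [hfx, ← hPx] at hbP
        have := hPi.1 hbP
        omega
      have hmp : m i ≤ p' := by
        by_contra! hlt
        refine hfY q' (Or.inr ⟨?_, ?_⟩)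
        · rw [← hpq']
          exact hmemX i i.2 p' hlt.le
        · intro hx'
          have := hf.1 ((Set.mem_singleton_iff.1 hx').trans hfx.symm)
          omega
      refine ⟨R, hR, fun n hn => hR1 n (hn.trans hmp), ?_⟩
      rintro e ⟨n, rfl⟩
      rcases lt_or_ge n p' with hn | hn
      · rw [hR1 n hn.le, hR1 (n + 1) hn]
        rcases lt_or_ge n (m i) with hn' | hn'
        · exact Or.inl ⟨n, hn', rfl⟩
        · obtain ⟨n, rfl⟩ := Nat.exists_eq_add_of_le hn'
          refine Or.inr (Or.inl ⟨n, ?_, rfl⟩)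
          rintro y hy
          obtain rfl := Option.some.inj (hst.symm.trans hy)
          simp only
          omega
      · obtain ⟨n, rfl⟩ := Nat.exists_eq_add_of_le hn
        rw [add_assoc, hR2, hR2]
        exact Or.inr (Or.inr ⟨_, hst, q' + n, by simp only; omega, rfl⟩)
  choose R hR using hR
  have hpE : ∀ i : J, ∀ n, p i n ∈ rayEdges (P i) := fun i n => ⟨_, rfl⟩
  have hFq : ∀ i : J, ∀ n < m i, ∀ f b, s(P i n, P i (n + 1)) ≠ q f b := fun i n hn f b h =>
    Set.disjoint_left.1 (hr f f.2).2.2.2 ⟨b, h⟩ (hmemF i i.2 n hn.le)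
  have hEd : ∀ i i' : J, i ≠ i' → Disjoint (E i) (E i') := by
    intro i i' hne
    have hPd : ∀ e, e ∈ rayEdges (P i) → e ∉ rayEdges (P i') := fun e he =>
      Set.disjoint_left.1 (hd i i.2 i' i'.2 fun h => hne (Subtype.ext h)) he
    rw [Set.disjoint_left]
    rintro e (⟨n, hn, rfl⟩ | ⟨n, hn, rfl⟩ | ⟨y, hy, b, hb, rfl⟩)
      (⟨n', hn', he⟩ | ⟨n', hn', he⟩ | ⟨y', hy', b', hb', he⟩)
    · exact hPd _ ⟨n, rfl⟩ ⟨n', he⟩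
    · exact hPd _ ⟨n, rfl⟩ (he ▸ hpE i' n')
    · exact hFq i n hn _ _ he
    · exact hPd _ (hpE i n) ⟨n', he⟩
    · exact hPd _ (hpE i n) (he ▸ hpE i' n')
    · exact absurd (h2 i' y' hy' i n b' hn he) (by omega)
    · exact hFq i' n' hn' _ _ he.symm
    · exact absurd (h2 i y hy i' n' b hn' he.symm) (by omega)
    · exact h3 i i' hne y hy y' hy' (hq _ _ _ _ he).1
  refine ⟨fun i => if hi : i ∈ J then R ⟨i, hi⟩ else P i, j₀.1, (hr j₀ j₀.2).1,
    (hr j₀ j₀.2).2.1, ?_, ?_⟩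
  · intro i hi
    simp only [dif_pos hi]
    obtain ⟨ha, hb, hc⟩ := hR ⟨i, hi⟩
    refine ⟨ha, hb, Set.disjoint_left.2 ?_⟩
    rintro e he ⟨b, hb⟩
    rcases hc he with ⟨n, hn, rfl⟩ | ⟨n, hn, rfl⟩ | ⟨y, hy, b', hb', rfl⟩
    · exact hFq ⟨i, hi⟩ n hn j₀ b hb
    · exact h4 _ n b hn hb
    · exact h5 _ y hy (hq _ j₀ _ b hb).1
  · intro i hi i' hi' hne
    simp only [dif_pos hi, dif_pos hi']
    exact (hEd ⟨i, hi⟩ ⟨i', hi'⟩ (by simpa using hne)).mono (hR _).2.2 (hR _).2.2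

lemma exists_rays_of_stuck {K : SimpleGraph V} {Y : Set V} {x : V} (hx : Fan K Y x)
    (hstuck : ∀ u, ¬ Fan K (insert x Y) u) :
    ∃ A : ℕ → ℕ → V, (∀ i, IsRay K (A i) ∧ A i 0 = x) ∧
      Pairwise fun i j => Disjoint (rayEdges (A i)) (rayEdges (A j)) := by
  classical
  refine exists_rays_of_extend (fun P m => ∃ J : Finset ℕ,
    (∀ i ∈ J, IsRay K (P i) ∧ P i 0 = x ∧ 1 ≤ m i) ∧ (∀ i, P i 0 = x) ∧ (∀ i ∉ J, m i = 0) ∧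
    ∀ i ∈ J, ∀ i' ∈ J, i ≠ i' → Disjoint (rayEdges (P i)) (rayEdges (P i'))) ?_ ?_ ?_ ?_
  · exact ⟨fun _ _ => x, fun _ => 0, ∅, by simp⟩
  · rintro P m ⟨J, hJ, hx0, hm, -⟩ i
    refine ⟨hx0 i, ?_⟩
    by_cases hi : i ∈ J
    · exact ⟨fun j _ => (hJ i hi).1.2 j, (hJ i hi).1.1.injOn⟩
    · rw [hm i hi]
      refine ⟨by simp, fun a ha b hb _ => ?_⟩
      simp only [Set.mem_Iic] at ha hb
      omega
  · rintro P m ⟨J, hJ, hx0, hm, hd⟩ i i' hne j hj j' hj' h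
    have hi : i ∈ J := by
      by_contra hi
      rw [hm i hi] at hj
      omega
    have hi' : i' ∈ J := by
      by_contra hi
      rw [hm i' hi] at hj'
      omega
    exact Set.disjoint_left.1 (hd i hi i' hi' hne) ⟨j, rfl⟩ ⟨j', h⟩
  · rintro P m ⟨J, hJ, hx0, hm, hd⟩ i
    by_cases hi : i ∈ J
    · refine ⟨P, Function.update m i (m i + 1), ⟨J, ?_, hx0, ?_, hd⟩, ?_, by simp⟩
      · intro k hk
        refine ⟨(hJ k hk).1, hx0 k, ?_⟩
        have := (hJ k hk).2.2
        simp only [Function.update_apply]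
        split_ifs <;> omega
      · intro k hk
        rw [Function.update_of_ne (by rintro rfl; exact hk hi)]
        exact hm k hk
      · refine fun k => ⟨?_, fun _ _ => rfl⟩
        simp only [Function.update_apply]
        split_ifs with h
        · subst h; omega
        · exact le_rfl
    · obtain ⟨R, Q, hQ, hQx, hR, hRd⟩ := exists_add_ray hx hstuck J P m hJ hd
      have hne : ∀ k ∈ J, k ≠ i := by rintro k hk rfl; exact hi hk
      refine ⟨fun k => if k ∈ J then R k else if k = i then Q else P k,
        Function.update m i 1, ⟨insert i J, ?_, ?_, ?_, ?_⟩, ?_, ?_⟩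
      · intro k hk
        rcases Finset.mem_insert.1 hk with rfl | hk
        · simp [hi, hQ, hQx]
        · simp only [if_pos hk, Function.update_of_ne (hne k hk)]
          exact ⟨(hR k hk).1, by rw [(hR k hk).2.1 0 (Nat.zero_le _), hx0], (hJ k hk).2.2⟩
      · intro k
        beta_reduce
        split_ifs with h1 h2
        · rw [(hR k h1).2.1 0 (Nat.zero_le _), hx0]
        · exact hQx
        · exact hx0 k
      · intro k hk
        simp only [Finset.mem_insert, not_or] at hk
        rw [Function.update_of_ne hk.1, hm k hk.2]
      · intro k hk k' hk' hkk
        rcases Finset.mem_insert.1 hk with h | h <;>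
          rcases Finset.mem_insert.1 hk' with h' | h'
        · exact absurd (h.trans h'.symm) hkk
        · subst h
          simp only [if_pos h', if_neg hi, if_true]
          exact (hR k' h').2.2.symm
        · subst h'
          simp only [if_pos h, if_neg hi, if_true]
          exact (hR k h).2.2
        · simp only [if_pos h, if_pos h']
          exact hRd k h k' h' hkk
      · intro k
        by_cases hk : k ∈ J
        · simp only [if_pos hk, Function.update_of_ne (hne k hk)]
          exact ⟨le_rfl, (hR k hk).2.1⟩
        · rw [hm k hk]
          refine ⟨Nat.zero_le _, fun j hj => ?_⟩
          obtain rfl : j = 0 := by omega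
          simp only [if_neg hk]
          split_ifs
          · rw [hQx, hx0]
          · rfl
      · simp [hm i hi]

/-- A fan that is not stuck at `x` can be moved along a path. -/
lemma Fan.exists_move {K : SimpleGraph V} (hone : ∀ f g, IsRay K f → IsRay K g → RayEquiv K f g)
    {Y : Set V} (hY : Y.Finite) {x w : V} (hx : Fan K Y x) (hw : Fan K (insert x Y) w)
    {F : Set (Sym2 V)} (hF : F.Finite) : ∃ (q : ℕ → V) (l : ℕ), 1 ≤ l ∧ q 0 = x ∧
      (∀ j < l, K.Adj (q j) (q (j + 1)) ∧ s(q j, q (j + 1)) ∉ F) ∧ Set.InjOn q (Set.Iic l) ∧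
      (∀ j ≤ l, q j ∉ Y) ∧ Fan K (Y ∪ q '' Set.Iio l) (q l) := by
  classical
  obtain ⟨f, hf, hfx, hfY, hfF⟩ := hx.exists_ray hF
  obtain ⟨g, hg, hgw, hgY, hgF⟩ := hw.exists_ray hF
  obtain ⟨a, b, -, -, hab⟩ := (hone f g hf hg).joined (hY.union (edgeEnds_finite hF))
  have h1 : (offGraph K Y F).Reachable x (f a) := hfx ▸ reachable_tail hf.2
    (a := 0) (fun i _ => hfY i) (fun i _ h => Set.disjoint_left.1 hfF ⟨i, rfl⟩ h) le_rfl
    (Nat.zero_le _)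
  have h2 : (offGraph K Y F).Reachable w (g b) := hgw ▸ reachable_tail hg.2
    (a := 0) (fun i _ h => hgY i (Set.mem_insert_of_mem _ h))
    (fun i _ h => Set.disjoint_left.1 hgF ⟨i, rfl⟩ h) le_rfl (Nat.zero_le _)
  obtain ⟨p, hp⟩ := ((h1.trans (hab.mono (offGraph_edgeEnds_le K Y F))).trans h2.symm).exists_isPath
  have hxw : x ≠ w := fun h => hw.notMem (h ▸ Set.mem_insert _ _)
  have hlen : 1 ≤ p.length := by
    by_contra! h
    exact hxw (Walk.eq_of_length_eq_zero (by omega : p.length = 0))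
  have hadj : ∀ j < p.length, (offGraph K Y F).Adj (p.getVert j) (p.getVert (j + 1)) :=
    fun j hj => p.adj_getVert_succ hj
  have hnY : ∀ j ≤ p.length, p.getVert j ∉ Y := by
    intro j hj
    rcases Nat.eq_zero_or_pos j with rfl | hj0
    · rw [p.getVert_zero]
      exact hx.notMem
    · obtain ⟨j, rfl⟩ := Nat.exists_eq_add_of_le hj0
      rw [Nat.add_comm]
      exact (hadj j (by omega)).2.2.1
  have key : ∀ n, 1 ≤ n → n ≤ p.length → (∃ l, 1 ≤ l ∧ l ≤ p.length ∧
      Fan K (Y ∪ p.getVert '' Set.Iio l) (p.getVert l)) ∨ Fan K (Y ∪ p.getVert '' Set.Iio n) w := by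
    intro n hn
    induction n, hn using Nat.le_induction with
    | base =>
      refine fun _ => Or.inr (hw.mono ?_)
      rintro v (hv | ⟨j, hj, rfl⟩)
      · exact Or.inr hv
      · obtain rfl : j = 0 := by simpa using hj
        exact Or.inl p.getVert_zero
    | succ n hn ih =>
      intro hn'
      rcases ih (by omega) with h | h
      · exact Or.inl h
      have hne : p.getVert n ≠ w := by
        intro h'
        have := hp.getVert_injOn (Set.mem_ofPred.2 (by omega : n ≤ p.length))
          (Set.mem_ofPred.2 le_rfl) (h'.trans p.getVert_length.symm)
        omega
      rcases h.insert_or hne with h | h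
      · refine Or.inr (h.mono ?_)
        rintro v (hv | ⟨j, hj, rfl⟩)
        · exact Or.inr (Or.inl hv)
        · rcases Nat.lt_succ_iff_lt_or_eq.1 (Set.mem_Iio.1 hj) with hj | rfl
          exacts [Or.inr (Or.inr ⟨j, hj, rfl⟩), Or.inl rfl]
      · exact Or.inl ⟨n, hn, by omega, h.mono (Set.subset_insert _ _)⟩
  have : ∃ l, 1 ≤ l ∧ l ≤ p.length ∧ Fan K (Y ∪ p.getVert '' Set.Iio l) (p.getVert l) := by
    rcases key p.length hlen le_rfl with h | h
    · exact h
    · exact ⟨p.length, hlen, le_rfl, by rwa [p.getVert_length]⟩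
  obtain ⟨l, hl, hlp, hfan⟩ := this
  refine ⟨p.getVert, l, hl, p.getVert_zero, fun j hj => ?_, ?_, fun j hj => hnY j (hj.trans hlp),
    hfan⟩
  · have := hadj j (by omega)
    exact ⟨this.1, this.2.2.2⟩
  · exact hp.getVert_injOn.mono fun j hj => le_trans hj hlp

lemma exists_rays_of_forall_move {K : SimpleGraph V}
    (hone : ∀ f g, IsRay K f → IsRay K g → RayEquiv K f g) {x : V} (hx : Fan K ∅ x)
    (hmove : ∀ (Y : Set V) y, Fan K Y y → ∃ u, Fan K (insert y Y) u) :
    ∃ A : ℕ → ℕ → V, (∀ i, IsRay K (A i) ∧ A i 0 = x) ∧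
      Pairwise fun i j => Disjoint (rayEdges (A i)) (rayEdges (A j)) := by
  classical
  refine exists_rays_of_extend (x := x) (fun P m => (∀ i, (P i 0 = x ∧
    (∀ j < m i, K.Adj (P i j) (P i (j + 1))) ∧ Set.InjOn (P i) (Set.Iic (m i))) ∧
      Fan K (P i '' Set.Iio (m i)) (P i (m i))) ∧
    (∀ i i', i ≠ i' → ∀ j < m i, ∀ j' < m i',
      s(P i j, P i (j + 1)) ≠ s(P i' j', P i' (j' + 1))) ∧ {i | m i ≠ 0}.Finite) ?_
    (fun P m h i => (h.1 i).1) (fun P m h => h.2.1) ?_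
  · refine ⟨fun _ _ => x, fun _ => 0, fun i => ⟨⟨rfl, by simp, ?_⟩, by simpa using hx⟩, by simp,
      by simp⟩
    intro a ha b hb _
    simp only [Set.mem_Iic] at ha hb
    omega
  · rintro P m ⟨hP, hd, hfin⟩ i
    obtain ⟨⟨hPx, hadj, hinj⟩, hfan⟩ := hP i
    set F : Set (Sym2 V) := ⋃ k ∈ {k | m k ≠ 0},
      (fun j => s(P k j, P k (j + 1))) '' Set.Iio (m k) with hFdef
    have hF : F.Finite := hfin.biUnion fun k _ => (Set.finite_Iio _).image _
    have hmemF : ∀ k, ∀ j < m k, s(P k j, P k (j + 1)) ∈ F := fun k j hj =>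
      Set.mem_biUnion (show m k ≠ 0 by omega) ⟨j, hj, rfl⟩
    obtain ⟨u, hu⟩ := hmove _ _ hfan
    obtain ⟨q, l, hl, hq0, hq, hqinj, hqY, hqfan⟩ :=
      hfan.exists_move hone ((Set.finite_Iio _).image _) hu hF
    let R : ℕ → V := fun n => if n ≤ m i then P i n else q (n - m i)
    have hR1 : ∀ n ≤ m i, R n = P i n := fun n hn => if_pos hn
    have hR2 : ∀ n, R (m i + n) = q n := by
      intro n
      rcases Nat.eq_zero_or_pos n with rfl | hn
      · simp [R, hq0]
      · simp only [R]
        rw [if_neg (by omega), Nat.add_sub_cancel_left]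
    have hRimg : ∀ n < m i, R n ∈ P i '' Set.Iio (m i) := fun n hn =>
      ⟨n, hn, (hR1 n hn.le).symm⟩
    have hRinj : ∀ a b, a < b → b ≤ m i + l → R a ≠ R b := by
      intro a b hab hb heq
      rcases lt_or_ge b (m i) with hb' | hb'
      · rw [hR1 a (by omega), hR1 b hb'.le] at heq
        have := hinj (Set.mem_Iic.2 (by omega)) (Set.mem_Iic.2 hb'.le) heq
        omega
      obtain ⟨b, rfl⟩ := Nat.exists_eq_add_of_le hb'
      rcases lt_or_ge a (m i) with ha | ha
      · refine hqY b (by omega) ?_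
        rw [← hR2, ← heq]
        exact hRimg a ha
      · obtain ⟨a, rfl⟩ := Nat.exists_eq_add_of_le ha
        rw [hR2, hR2] at heq
        have := hqinj (Set.mem_Iic.2 (by omega)) (Set.mem_Iic.2 (by omega)) heq
        omega
    have hRedge : ∀ j < m i + l, (∃ j' < m i, s(R j, R (j + 1)) = s(P i j', P i (j' + 1))) ∨
        ∃ j' < l, s(R j, R (j + 1)) = s(q j', q (j' + 1)) := by
      intro j hj
      rcases lt_or_ge j (m i) with hj' | hj'
      · exact Or.inl ⟨j, hj', by rw [hR1 j hj'.le, hR1 (j + 1) hj']⟩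
      · obtain ⟨j, rfl⟩ := Nat.exists_eq_add_of_le hj'
        exact Or.inr ⟨j, by omega, by rw [add_assoc, hR2, hR2]⟩
    have hRdisj : ∀ k, k ≠ i → ∀ j < m i + l, ∀ j' < m k,
        s(R j, R (j + 1)) ≠ s(P k j', P k (j' + 1)) := by
      intro k hk j hj j' hj' h
      rcases hRedge j hj with ⟨n, hn, h'⟩ | ⟨n, hn, h'⟩
      · exact hd i k hk.symm n hn j' hj' (h'.symm.trans h)
      · refine (hq n hn).2 ?_
        rw [← h', h]
        exact hmemF k j' hj'
    refine ⟨Function.update P i R, Function.update m i (m i + l), ⟨?_, ?_, ?_⟩, ?_, ?_⟩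
    · intro k
      by_cases hk : k = i
      · subst hk
        simp only [Function.update_self]
        refine ⟨⟨?_, ?_, ?_⟩, ?_⟩
        · rw [hR1 0 (Nat.zero_le _), hPx]
        · intro j hj
          rcases lt_or_ge j (m k) with hj' | hj'
          · rw [hR1 j hj'.le, hR1 (j + 1) hj']
            exact hadj j hj'
          · obtain ⟨j, rfl⟩ := Nat.exists_eq_add_of_le hj'
            rw [add_assoc, hR2, hR2]
            exact (hq j (by omega)).1
        · intro a ha b hb hab
          rcases lt_trichotomy a b with h | h | h
          exacts [absurd hab (hRinj a b h hb), h, absurd hab.symm (hRinj b a h ha)]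
        · rw [hR2]
          refine hqfan.mono ?_
          rintro v ⟨n, hn, rfl⟩
          rcases lt_or_ge n (m k) with hn' | hn'
          · exact Or.inl (hRimg n hn')
          · obtain ⟨n, rfl⟩ := Nat.exists_eq_add_of_le hn'
            refine Or.inr ⟨n, ?_, (hR2 n).symm⟩
            simp only [Set.mem_Iio] at hn ⊢
            omega
      · simp only [Function.update_of_ne hk]
        exact hP k
    · intro k k' hkk j hj j' hj'
      by_cases hk : k = i
      · subst hk
        rw [Function.update_of_ne hkk.symm] at hj' ⊢
        rw [Function.update_self] at hj ⊢
        exact hRdisj k' hkk.symm j hj j' hj'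
      · by_cases hk' : k' = i
        · subst hk'
          rw [Function.update_of_ne hkk] at hj ⊢
          rw [Function.update_self] at hj' ⊢
          exact (hRdisj k hkk j' hj' j hj).symm
        · rw [Function.update_of_ne hk] at hj ⊢
          rw [Function.update_of_ne hk'] at hj' ⊢
          exact hd k k' hkk j hj j' hj'
    · refine (hfin.insert i).subset fun k hk => ?_
      by_cases hki : k = i
      · exact Or.inl hki
      · right
        simpa [Function.update_of_ne hki] using hk
    · intro k
      by_cases hk : k = i
      · subst hk
        simp only [Function.update_self]
        exact ⟨by omega, hR1⟩
      · simp [Function.update_of_ne hk]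
    · simp only [Function.update_self]
      omega

/-- In a one-ended graph, if some vertex is the start of arbitrarily many edge-disjoint rays then
some vertex is the start of infinitely many. -/
lemma exists_rays_of_fan {K : SimpleGraph V}
    (hone : ∀ f g, IsRay K f → IsRay K g → RayEquiv K f g) {x₀ : V} (hx : Fan K ∅ x₀) :
    ∃ (x : V) (A : ℕ → ℕ → V), (∀ i, IsRay K (A i) ∧ A i 0 = x) ∧
      Pairwise fun i j => Disjoint (rayEdges (A i)) (rayEdges (A j)) := by
  by_cases hmove : ∀ (Y : Set V) y, Fan K Y y → ∃ u, Fan K (insert y Y) u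
  · exact ⟨x₀, exists_rays_of_forall_move hone hx hmove⟩
  · push Not at hmove
    obtain ⟨Y, y, hy, hstuck⟩ := hmove
    exact ⟨y, exists_rays_of_stuck hy hstuck⟩

/-- The vertices joined to a tail of `W` in the complement of `S`. -/
def endComp (G : SimpleGraph V) (S : Set V) (W : ℕ → V) : Set V :=
  {v | ∃ a, (∀ i, a ≤ i → W i ∉ S) ∧ (offGraph G S ∅).Reachable (W a) v}

/-- The graph formed by all edges with an endpoint in `C`. -/
def touching (G : SimpleGraph V) (C : Set V) : SimpleGraph V where
  Adj u v := G.Adj u v ∧ (u ∈ C ∨ v ∈ C)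
  symm := ⟨fun _ _ h => ⟨h.1.symm, h.2.symm⟩⟩
  loopless := ⟨fun _ h => h.1.ne rfl⟩

lemma touching_le (G : SimpleGraph V) (C : Set V) : touching G C ≤ G := fun _ _ h => h.1

lemma notMem_of_reachable {G : SimpleGraph V} {S : Set V} {F : Set (Sym2 V)} {u v : V}
    (hu : u ∉ S) (h : (offGraph G S F).Reachable u v) : v ∉ S := by
  obtain ⟨w, hw, -⟩ := exists_walk_of_reachable_offGraph hu h
  exact hw _ w.end_mem_support

lemma notMem_of_mem_endComp {G : SimpleGraph V} {S : Set V} {W : ℕ → V} {v : V}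
    (hv : v ∈ endComp G S W) : v ∉ S := by
  obtain ⟨a, ha, h⟩ := hv
  exact notMem_of_reachable (ha a le_rfl) h

lemma mem_endComp_of_reachable {G : SimpleGraph V} {S : Set V} {W : ℕ → V} {u v : V}
    (hu : u ∈ endComp G S W) (h : (offGraph G S ∅).Reachable u v) : v ∈ endComp G S W := by
  obtain ⟨a, ha, h'⟩ := hu
  exact ⟨a, ha, h'.trans h⟩

lemma mem_endComp_of_adj {G : SimpleGraph V} {S : Set V} {W : ℕ → V} {u v : V}
    (hu : u ∈ endComp G S W) (h : G.Adj u v) (hv : v ∉ S) : v ∈ endComp G S W :=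
  mem_endComp_of_reachable hu
    (Adj.reachable ⟨h, notMem_of_mem_endComp hu, hv, Set.notMem_empty _⟩)

lemma mem_endComp_of_tail {G : SimpleGraph V} {S : Set V} {W f : ℕ → V} (hf : IsRay G f) {b i : ℕ}
    (hb : ∀ j, b ≤ j → f j ∉ S) (hi : b ≤ i) (hC : f i ∈ endComp G S W) :
    ∀ j, b ≤ j → f j ∈ endComp G S W := fun _ hj =>
  mem_endComp_of_reachable hC (reachable_tail hf.2 hb (by simp) hi hj)

lemma RayEquiv.exists_tail_mem_endComp {G : SimpleGraph V} {S : Set V} (hS : S.Finite)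
    {W f : ℕ → V} (hf : IsRay G f) (h : RayEquiv G W f) :
    ∃ b, ∀ j, b ≤ j → f j ∈ endComp G S W := by
  obtain ⟨a, b, ha, hb, hr⟩ := h.joined hS
  exact ⟨b, mem_endComp_of_tail hf hb le_rfl ⟨a, ha, hr⟩⟩

lemma IsRay.exists_tail_mem_endComp {G : SimpleGraph V} {S : Set V} (hS : S.Finite)
    {W f : ℕ → V} (hf : IsRay (touching G (endComp G S W)) f) :
    ∃ b, (∀ j, b ≤ j → f j ∉ S) ∧ ∀ j, b ≤ j → f j ∈ endComp G S W := by
  obtain ⟨b, hb⟩ := hf.exists_tail_notMem hS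
  refine ⟨b, hb, ?_⟩
  have hf' := hf.mono (touching_le _ _)
  rcases (hf.2 b).2 with h | h
  · exact mem_endComp_of_tail hf' hb le_rfl h
  · exact mem_endComp_of_tail hf' hb (Nat.le_succ b) h

/-- In a graph with finitely many ends, a finite set separates a given end from all others. -/
lemma exists_separator {G : SimpleGraph V} {N : ℕ} {E : Fin N → ℕ → V} (hE : ∀ i, IsRay G (E i))
    (hall : ∀ f : ℕ → V, IsRay G f → ∃ i, RayEquiv G (E i) f) (W : ℕ → V) :
    ∃ S : Set V, S.Finite ∧ ∀ T, S ⊆ T → T.Finite → ∀ f, IsRay G f → ∀ b,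
      (∀ j, b ≤ j → f j ∉ T) → f b ∈ endComp G T W → RayEquiv G W f := by
  have h1 : ∀ i, ∃ S : Set V, S.Finite ∧ (¬ RayEquiv G W (E i) → ∀ a b, (∀ n, a ≤ n → W n ∉ S) →
      (∀ n, b ≤ n → E i n ∉ S) → ¬ (offGraph G S ∅).Reachable (W a) (E i b)) := by
    intro i
    by_contra! hcon
    refine (hcon ∅ Set.finite_empty).1 (rayEquiv_of_joined fun S hS => ?_)
    exact (hcon S hS).2
  choose S hS hsep using h1
  refine ⟨⋃ i, S i, Set.finite_iUnion hS, fun T hST hT f hf b hb hC => ?_⟩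
  obtain ⟨i, hi⟩ := hall f hf
  by_cases hW : RayEquiv G W (E i)
  · exact hW.trans (hE i).2 hi
  · exfalso
    obtain ⟨a, ha, hr⟩ := hC
    obtain ⟨c, d, hc, hd, hr'⟩ := hi.joined hT
    have hSi : S i ⊆ T := (Set.subset_iUnion S i).trans hST
    refine hsep i hW a c (fun n hn h => ha n hn (hSi h)) (fun n hn h => hc n hn (hSi h)) ?_
    refine Reachable.mono (offGraph_mono G hSi subset_rfl) (hr.trans (Reachable.trans ?_ hr'.symm))
    rcases le_total b d with hbd | hbd
    · exact reachable_tail hf.2 hb (by simp) le_rfl hbd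
    · exact reachable_tail hf.2 hd (by simp) hbd le_rfl

lemma reachable_touching {G : SimpleGraph V} {S T : Set V} {W : ℕ → V} {u v : V}
    (hu : u ∈ endComp G S W) (h : (offGraph G (S ∪ T) ∅).Reachable u v) :
    (offGraph (touching G (endComp G S W)) T ∅).Reachable u v := by
  obtain ⟨p⟩ := h
  induction p with
  | nil => exact Reachable.refl _
  | cons h p ih =>
    refine Reachable.trans (Adj.reachable ?_)
      (ih (mem_endComp_of_adj hu h.1 fun h' => h.2.2.1 (Or.inl h')))
    exact ⟨⟨h.1, Or.inl hu⟩, fun h' => h.2.1 (Or.inr h'), fun h' => h.2.2.1 (Or.inr h'), h.2.2.2⟩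

section Separated

variable {G : SimpleGraph V} {S : Set V} {W : ℕ → V}

lemma rayEquiv_of_isRay_touching (hS : S.Finite) (hsep : ∀ f, IsRay G f → ∀ b,
    (∀ j, b ≤ j → f j ∉ S) → f b ∈ endComp G S W → RayEquiv G W f) {f : ℕ → V}
    (hf : IsRay (touching G (endComp G S W)) f) : RayEquiv G W f := by
  obtain ⟨b, hb, hC⟩ := hf.exists_tail_mem_endComp hS
  exact hsep f (hf.mono (touching_le _ _)) b hb (hC b le_rfl)

lemma rayEquiv_touching (hW : IsRay G W) (hS : S.Finite) (hsep : ∀ f, IsRay G f → ∀ b,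
    (∀ j, b ≤ j → f j ∉ S) → f b ∈ endComp G S W → RayEquiv G W f) (f g : ℕ → V)
    (hf : IsRay (touching G (endComp G S W)) f) (hg : IsRay (touching G (endComp G S W)) g) :
    RayEquiv (touching G (endComp G S W)) f g := by
  refine rayEquiv_of_joined fun T hT => ?_
  obtain ⟨a, b, ha, hb, hr⟩ := ((rayEquiv_of_isRay_touching hS hsep hf).symm.trans hW.2
    (rayEquiv_of_isRay_touching hS hsep hg)).joined (hS.union hT)
  refine ⟨a, b, fun i hi h => ha i hi (Or.inr h), fun i hi h => hb i hi (Or.inr h),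
    reachable_touching ?_ hr⟩
  obtain ⟨c, hc, hC⟩ := hf.exists_tail_mem_endComp hS
  exact mem_endComp_of_tail (hf.mono (touching_le _ _)) (fun i hi h => ha i hi (Or.inl h))
    (le_max_left a c) (hC _ (le_max_right a c)) a le_rfl

end Separated

lemma exists_ray_of_doubleRay {G : SimpleGraph V} {S : Set V} {W : ℕ → V} {g : ℤ → V}
    (hg : IsDoubleRay G g) (hfwd : ∃ b, ∀ n, b ≤ n → g n ∈ endComp G S W)
    (hbwd : ∃ n, g n ∉ endComp G S W) :
    ∃ f, IsRay (touching G (endComp G S W)) f ∧ f 0 ∈ S ∧ rayEdges f ⊆ drEdges g := by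
  obtain ⟨b, hb⟩ := hfwd
  obtain ⟨n, hn, hmax⟩ := Int.exists_greatest_of_bdd (P := fun n => g n ∉ endComp G S W)
    ⟨b, fun z hz => le_of_not_ge fun h => hz (hb z h)⟩ hbwd
  have hC : ∀ m, n < m → g m ∈ endComp G S W := fun m hm => by
    by_contra h
    exact absurd (hmax m h) (by omega)
  refine ⟨fun k => g (n + k), ⟨fun i j h => ?_, fun k => ⟨?_, Or.inr (hC _ ?_)⟩⟩, ?_, ?_⟩
  · have := hg.1 h
    omega
  · have := hg.2 (n + k)
    rwa [add_assoc] at this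
  · push_cast; omega
  · by_contra h
    simp only [Nat.cast_zero, add_zero] at h
    exact hn (mem_endComp_of_adj (hC (n + 1) (by omega)) (hg.2 n).symm h)
  · rintro e ⟨k, rfl⟩
    exact ⟨n + k, by push_cast; rw [add_assoc]⟩

lemma drFwd_isRay {G : SimpleGraph V} {g : ℤ → V} (hg : IsDoubleRay G g) : IsRay G (drFwd g) :=
  ⟨fun i j h => by have := hg.1 h; omega, fun n => hg.2 n⟩

lemma drBwd_isRay {G : SimpleGraph V} {g : ℤ → V} (hg : IsDoubleRay G g) : IsRay G (drBwd g) := by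
  refine ⟨fun i j h => by have := hg.1 h; omega, fun n => ?_⟩
  have := (hg.2 (-((n + 1 : ℕ) : ℤ) - 1)).symm
  rwa [show -((n + 1 : ℕ) : ℤ) - 1 + 1 = -(n : ℤ) - 1 by push_cast; ring] at this

lemma ConvBoth.symm {G : SimpleGraph V} {W₁ W₂ : ℕ → V} {D : ℤ → V} (h : ConvBoth G W₁ W₂ D) :
    ConvBoth G W₂ W₁ D := h.elim (fun h => Or.inr ⟨h.2, h.1⟩) fun h => Or.inl ⟨h.2, h.1⟩

/-- A double ray joining two separated ends contains a ray of the first end that starts in the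
separator. -/
lemma ConvBoth.exists_ray {G : SimpleGraph V} {S : Set V} (hS : S.Finite) {W₁ W₂ : ℕ → V}
    (hC : Disjoint (endComp G S W₁) (endComp G S W₂)) {g : ℤ → V} (hg : IsDoubleRay G g)
    (h : ConvBoth G W₁ W₂ g) : ∃ f, IsRay (touching G (endComp G S W₁)) f ∧ f 0 ∈ S ∧
      rayEdges f ⊆ drEdges g := by
  rcases h with ⟨h₁, h₂⟩ | ⟨h₁, h₂⟩
  · obtain ⟨a, ha⟩ := h₁.exists_tail_mem_endComp hS (drFwd_isRay hg)
    obtain ⟨b, hb⟩ := h₂.exists_tail_mem_endComp hS (drBwd_isRay hg)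
    refine exists_ray_of_doubleRay hg ⟨a, fun n hn => ?_⟩
      ⟨_, Set.disjoint_right.1 hC (hb b le_rfl)⟩
    obtain ⟨n, rfl⟩ := Int.eq_ofNat_of_zero_le (by omega : 0 ≤ n)
    exact ha n (by omega)
  · obtain ⟨a, ha⟩ := h₁.exists_tail_mem_endComp hS (drBwd_isRay hg)
    obtain ⟨b, hb⟩ := h₂.exists_tail_mem_endComp hS (drFwd_isRay hg)
    have hg' : IsDoubleRay G fun n => g (-n) := by
      refine ⟨fun i j h => neg_injective (hg.1 h), fun n => ?_⟩
      have := (hg.2 (-(n + 1))).symm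
      rwa [show -(n + 1) + 1 = -n by ring] at this
    have ha' : ∀ n : ℤ, a + 1 ≤ n → g (-n) ∈ endComp G S W₁ := by
      intro n hn
      obtain ⟨n, rfl⟩ := Int.eq_ofNat_of_zero_le (by omega : 0 ≤ n)
      obtain ⟨n, rfl⟩ := Nat.exists_eq_add_of_le' (show 1 ≤ n by omega)
      have := ha n (by omega)
      simp only [drBwd] at this
      convert this using 2
      push_cast
      ring
    obtain ⟨f, hf, hf0, hfe⟩ := exists_ray_of_doubleRay (S := S) (W := W₁) hg' ⟨a + 1, ha'⟩
      ⟨-b, Set.disjoint_right.1 hC (by simpa [drFwd] using hb b le_rfl)⟩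
    refine ⟨f, hf, hf0, hfe.trans ?_⟩
    rintro e ⟨n, rfl⟩
    exact ⟨-(n + 1), by rw [Sym2.eq_swap, show -(n + 1) + 1 = -n by ring]⟩

lemma exists_fan_touching {G : SimpleGraph V} {S : Set V} (hS : S.Finite) {W₁ W₂ : ℕ → V}
    (hC : Disjoint (endComp G S W₁) (endComp G S W₂))
    (h : ∀ k : ℕ, ∃ F : Fin k → ℤ → V, (∀ i, IsDoubleRay G (F i) ∧ ConvBoth G W₁ W₂ (F i)) ∧
      Pairwise fun i j => Disjoint (drEdges (F i)) (drEdges (F j))) :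
    ∃ x, Fan (touching G (endComp G S W₁)) ∅ x := by
  classical
  refine exists_fan_of_finite_starts hS fun k => ?_
  obtain ⟨F, hF, hd⟩ := h k
  have h1 := fun i => (hF i).2.exists_ray hS hC (hF i).1
  choose f hf hf0 hfe using h1
  have hfd : ∀ i j, i ≠ j → Disjoint (rayEdges (f i)) (rayEdges (f j)) := fun i j hij =>
    (hd hij).mono (hfe i) (hfe j)
  have hinj : Function.Injective f := by
    intro i j hij
    by_contra hne
    obtain ⟨e, he⟩ := rayEdges_nonempty (f i)
    exact Set.disjoint_left.1 (hfd i j hne) he (hij ▸ he)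
  refine ⟨Finset.univ.image f, ?_, ?_, ?_⟩
  · rw [Finset.card_image_of_injective _ hinj, Finset.card_univ, Fintype.card_fin]
  · intro g hg
    obtain ⟨i, -, rfl⟩ := Finset.mem_image.1 hg
    exact ⟨hf i, hf0 i⟩
  · intro g hg g' hg' hne
    obtain ⟨i, -, rfl⟩ := Finset.mem_image.1 hg
    obtain ⟨j, -, rfl⟩ := Finset.mem_image.1 hg'
    exact hfd i j fun h => hne (h ▸ rfl)

/-- The two sequences share vertices beyond any index. -/
def MeetsInf (f g : ℕ → V) : Prop := ∀ n, ∃ i ≥ n, ∃ j ≥ n, f i = g j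

/-- In an infinite set of rays of a thin end one can find an infinite subset each member of which
shares infinitely many vertices with infinitely many members. -/
lemma EndVertexDegree.exists_subfamily {G : SimpleGraph V} {W : ℕ → V} {k : ℕ}
    (hdeg : EndVertexDegree G W k) {A : ℕ → ℕ → V}
    (hA : ∀ i, IsRay G (A i) ∧ RayEquiv G W (A i)) :
    ∃ φ : ℕ → ℕ, Function.Injective φ ∧ ∀ i, {j | MeetsInf (A (φ i)) (A (φ j))}.Infinite := by
  classical
  let U : Ultrafilter ℕ := Filter.hyperfilter ℕ
  have hU : ∀ s : Set ℕ, s ∈ U → s.Infinite := fun s hs hfin =>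
    Filter.notMem_hyperfilter_of_finite hfin hs
  set I : Set ℕ := {i | {j | MeetsInf (A i) (A j)} ∈ U} with hI
  rcases U.mem_or_compl_mem I with h | h
  · have hinf := hU I h
    refine ⟨Nat.nth (· ∈ I), Nat.nth_injective hinf, fun i => ?_⟩
    have hi : Nat.nth (· ∈ I) i ∈ I := Nat.nth_mem_of_infinite hinf i
    have h1 := hU _ (Filter.inter_mem h (show {j | MeetsInf (A (Nat.nth (· ∈ I) i)) (A j)} ∈ U
      from hi))
    refine (h1.preimage (f := Nat.nth (· ∈ I)) ?_).mono fun j hj => hj.2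
    exact fun j hj => (Nat.range_nth_of_infinite (p := (· ∈ I)) hinf).ge hj.1
  · exfalso
    obtain ⟨ψ, -, hψ⟩ := exists_seq_of_forall_finset_exists (fun i => i ∉ I)
      (fun i j => ¬ MeetsInf (A i) (A j)) (by
        intro s hs
        have h1 : Iᶜ ∩ ⋂ i ∈ s, {j | MeetsInf (A i) (A j)}ᶜ ∈ U := by
          refine Filter.inter_mem h ((Filter.biInter_finset_mem s).2 fun i hi => ?_)
          exact Ultrafilter.compl_mem_iff_notMem.2 (hs i hi)
        obtain ⟨j, hj, hj'⟩ := (hU _ h1).nonempty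
        exact ⟨j, hj, fun i hi => Set.mem_iInter₂.1 hj' i hi⟩)
    have h2 : ∀ m n, ∃ N, m < n → ∀ i ≥ N, ∀ j ≥ N, A (ψ m) i ≠ A (ψ n) j := by
      intro m n
      by_cases hmn : m < n
      · have := hψ m n hmn
        simp only [MeetsInf, not_forall] at this
        obtain ⟨N, hN⟩ := this
        push Not at hN
        exact ⟨N, fun _ => hN⟩
      · exact ⟨0, fun h => absurd h hmn⟩
    choose M hM using h2
    let B := ∑ m ∈ Finset.range (k + 1), ∑ n ∈ Finset.range (k + 1), M m n
    have hB : ∀ m n, m < k + 1 → n < k + 1 → M m n ≤ B := by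
      intro m n hm hn
      refine le_trans ?_ (Finset.single_le_sum (f := fun m => ∑ n ∈ Finset.range (k + 1), M m n)
        (fun _ _ => Nat.zero_le _) (Finset.mem_range.2 hm))
      exact Finset.single_le_sum (f := fun n => M m n) (fun _ _ => Nat.zero_le _)
        (Finset.mem_range.2 hn)
    have hlt : ∀ m n, m < n → n < k + 1 → Disjoint (Set.range fun i => A (ψ m) (B + i))
        (Set.range fun i => A (ψ n) (B + i)) := by
      intro m n hmn hn
      rw [Set.disjoint_left]
      rintro v ⟨i, rfl⟩ ⟨j, hj⟩
      have := hB m n (by omega) hn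
      exact hM m n hmn (B + i) (by omega) (B + j) (by omega) hj.symm
    refine hdeg.2 ⟨fun m i => A (ψ m) (B + i), fun m => ⟨(hA _).1.tail B, ?_⟩, ?_⟩
    · exact (hA _).2.trans (hA _).1.2
        (rayEquiv_of_common_tail (hA (ψ m)).1 ((hA (ψ m)).1.tail B) (a := B) (b := 0)
          fun n => by simp)
    · intro m n hmn
      rcases lt_or_gt_of_ne (fun h => hmn (Fin.ext h) : (m : ℕ) ≠ n) with h | h
      · exact hlt m n h n.2
      · exact (hlt n m h m.2).symm

lemma exists_disjoint_of_ncard_lt {ι α : Type*} [Fintype ι] {E : ι → Set α}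
    (hE : Pairwise fun i j => Disjoint (E i) (E j)) {F : Set α} (hF : F.Finite)
    (hlt : F.ncard < Fintype.card ι) : ∃ i, Disjoint (E i) F := by
  classical
  by_contra! hcon
  have h := card_filter_not_disjoint_le (s := Finset.univ) (fun i _ j _ hij => hE hij) hF
  rw [Finset.filter_true_of_mem fun i _ => hcon i, Finset.card_univ] at h
  omega

lemma RayEquiv.reachable {G : SimpleGraph V} {f g : ℕ → V} (h : RayEquiv G f g) (hf : IsRay G f)
    (hg : IsRay G g) {F : Set (Sym2 V)} (hF : F.Finite) (hfF : Disjoint (rayEdges f) F)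
    (hgF : Disjoint (rayEdges g) F) : (offGraph G ∅ F).Reachable (f 0) (g 0) := by
  obtain ⟨a, b, -, -, hab⟩ := h.joined (Set.finite_empty.union (edgeEnds_finite hF))
  have h1 : (offGraph G ∅ F).Reachable (f 0) (f a) := reachable_tail hf.2 (by simp)
    (fun i _ h => Set.disjoint_left.1 hfF ⟨i, rfl⟩ h) le_rfl (Nat.zero_le _)
  have h2 : (offGraph G ∅ F).Reachable (g 0) (g b) := reachable_tail hg.2 (by simp)
    (fun i _ h => Set.disjoint_left.1 hgF ⟨i, rfl⟩ h) le_rfl (Nat.zero_le _)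
  exact (h1.trans (hab.mono (offGraph_edgeEnds_le G ∅ F))).trans h2.symm

/-- The starting vertices of two infinite families of edge-disjoint rays, one for each end, are
joined by infinitely many edge-disjoint walks. -/
lemma exists_disjoint_walks {G : SimpleGraph V} {W₁ W₂ : ℕ → V} {x₁ x₂ : V} {A B : ℕ → ℕ → V}
    (h : ∀ k : ℕ, ∃ F : Fin k → ℤ → V, (∀ i, IsDoubleRay G (F i) ∧ ConvBoth G W₁ W₂ (F i)) ∧
      Pairwise fun i j => Disjoint (drEdges (F i)) (drEdges (F j)))
    (h₁ : IsRay G W₁) (h₂ : IsRay G W₂)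
    (hA : ∀ i, IsRay G (A i) ∧ A i 0 = x₁ ∧ RayEquiv G W₁ (A i))
    (hAd : Pairwise fun i j => Disjoint (rayEdges (A i)) (rayEdges (A j)))
    (hB : ∀ i, IsRay G (B i) ∧ B i 0 = x₂ ∧ RayEquiv G W₂ (B i))
    (hBd : Pairwise fun i j => Disjoint (rayEdges (B i)) (rayEdges (B j))) :
    ∃ D : ℕ → G.Walk x₂ x₁, Pairwise fun i j => (D i).edges.Disjoint (D j).edges := by
  classical
  have key : ∀ F : Set (Sym2 V), F.Finite → ∃ w : G.Walk x₂ x₁, ∀ e ∈ w.edges, e ∉ F := by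
    intro F hF
    have hfam : ∀ {A : ℕ → ℕ → V}, (Pairwise fun i j => Disjoint (rayEdges (A i))
        (rayEdges (A j))) → ∃ i, Disjoint (rayEdges (A i)) F := by
      intro A hAd
      obtain ⟨i, hi⟩ := exists_disjoint_of_ncard_lt (ι := Fin (F.ncard + 1))
        (E := fun i => rayEdges (A i)) (fun i j hij => hAd fun h => hij (Fin.ext h)) hF (by simp)
      exact ⟨i, hi⟩
    obtain ⟨i, hi⟩ := hfam hAd
    obtain ⟨j, hj⟩ := hfam hBd
    obtain ⟨Z, hZ, hZd⟩ := h (F.ncard + 1)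
    obtain ⟨l, hl⟩ := exists_disjoint_of_ncard_lt hZd hF (by simp)
    obtain ⟨hAr, hAx, hAW⟩ := hA i
    obtain ⟨hBr, hBx, hBW⟩ := hB j
    obtain ⟨hg, hconv⟩ := hZ l
    have hfwd : Disjoint (rayEdges (drFwd (Z l))) F := hl.mono_left (by
      rintro e ⟨n, rfl⟩
      exact ⟨n, rfl⟩)
    have hbwd : Disjoint (rayEdges (drBwd (Z l))) F := hl.mono_left (by
      rintro e ⟨n, rfl⟩
      refine ⟨-((n + 1 : ℕ) : ℤ) - 1, ?_⟩
      rw [Sym2.eq_swap, drBwd, drBwd]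
      congr 3
      push_cast
      ring)
    have hmid : (offGraph G ∅ F).Reachable (drBwd (Z l) 0) (drFwd (Z l) 0) := by
      refine Adj.reachable ⟨?_, Set.notMem_empty _, Set.notMem_empty _, ?_⟩
      · simpa [drBwd, drFwd] using hg.2 (-1)
      · exact Set.disjoint_left.1 hl ⟨-1, by simp [drBwd, drFwd]⟩
    have hreach : (offGraph G ∅ F).Reachable x₂ x₁ := by
      rw [← hAx, ← hBx]
      rcases hconv with ⟨hc₁, hc₂⟩ | ⟨hc₁, hc₂⟩
      · exact ((hBW.symm.trans h₂.2 hc₂).reachable hBr (drBwd_isRay hg) hF hj hbwd).trans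
          (hmid.trans ((hAW.symm.trans h₁.2 hc₁).reachable hAr (drFwd_isRay hg) hF hi hfwd).symm)
      · exact ((hBW.symm.trans h₂.2 hc₂).reachable hBr (drFwd_isRay hg) hF hj hfwd).trans
          (hmid.symm.trans
            ((hAW.symm.trans h₁.2 hc₁).reachable hAr (drBwd_isRay hg) hF hi hbwd).symm)
    obtain ⟨w, -, hw⟩ := exists_walk_of_reachable_offGraph (Set.notMem_empty _) hreach
    exact ⟨w, hw⟩
  obtain ⟨D, -, hD⟩ := exists_seq_of_forall_finset_exists (fun _ : G.Walk x₂ x₁ => True)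
    (fun w w' => w.edges.Disjoint w'.edges) (by
      intro s _
      obtain ⟨w, hw⟩ := key (⋃ w ∈ s, {e | e ∈ w.edges})
        (s.finite_toSet.biUnion fun w _ => w.edges.finite_toSet)
      exact ⟨w, trivial, fun w' hw' e he he' => hw e he' (Set.mem_biUnion hw' he)⟩)
  refine ⟨D, fun i j hij => ?_⟩
  rcases lt_or_gt_of_ne hij with h | h
  exacts [hD i j h, (hD j i h).symm]

/-- The initial part of a walk before its first edge in `E`. -/
lemma exists_initial_walk {G : SimpleGraph V} (E : Set (Sym2 V)) {u v : V} (w : G.Walk u v) :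
    (∀ e ∈ w.edges, e ∉ E) ∨ ∃ (z : V) (p : G.Walk u z), p.edges ⊆ w.edges ∧
      (∀ e ∈ p.edges, e ∉ E) ∧ ∃ e ∈ E, e ∈ w.edges ∧ z ∈ e := by
  induction w with
  | nil => exact Or.inl (by simp)
  | @cons u v' _ h w ih =>
    by_cases he : s(u, v') ∈ E
    · exact Or.inr ⟨u, Walk.nil, by simp, by simp, _, he, by simp, Sym2.mem_mk_left _ _⟩
    · rcases ih with ih | ⟨z, p, hp, hpE, e, heE, hew, hz⟩
      · left
        intro e
        rw [Walk.edges_cons, List.mem_cons]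
        rintro (rfl | h')
        exacts [he, ih e h']
      · refine Or.inr ⟨z, Walk.cons h p, ?_, ?_, e, heE, ?_, hz⟩
        · rw [Walk.edges_cons, Walk.edges_cons]
          exact List.cons_subset_cons _ hp
        · intro e
          rw [Walk.edges_cons, List.mem_cons]
          rintro (rfl | h')
          exacts [he, hpE e h']
        · rw [Walk.edges_cons]
          exact List.mem_cons_of_mem _ hew

lemma exists_walk_segment {G : SimpleGraph V} {f : ℕ → V} (hf : ∀ n, G.Adj (f n) (f (n + 1)))
    {p s : ℕ} (h : p ≤ s) : ∃ w : G.Walk (f p) (f s),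
      ∀ e ∈ w.edges, ∃ l, p ≤ l ∧ l < s ∧ e = s(f l, f (l + 1)) := by
  induction s, h using Nat.le_induction with
  | base => exact ⟨Walk.nil, by simp⟩
  | succ s hs ih =>
    obtain ⟨w, hw⟩ := ih
    refine ⟨w.concat (hf s), fun e he => ?_⟩
    rw [Walk.edges_concat, List.concat_eq_append, List.mem_append, List.mem_singleton] at he
    rcases he with he | rfl
    · obtain ⟨l, h1, h2, h3⟩ := hw e he
      exact ⟨l, h1, by omega, h3⟩
    · exact ⟨s, hs, by omega, rfl⟩

section Tails

variable {G : SimpleGraph V} {a : ℕ → V} {A : ℕ → ℕ → V}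

/-- Infinitely many edge-disjoint walks from the vertices in `a` to tails of distinct rays in
`A`, edge-disjoint from these tails. -/
def HasWalksToTails (G : SimpleGraph V) (a : ℕ → V) (A : ℕ → ℕ → V) (E : Set (Sym2 V)) : Prop :=
  ∃ (σ τ t : ℕ → ℕ) (w : ℕ → V) (P : ∀ n, G.Walk (a (σ n)) (w n)),
    Function.Injective σ ∧ Function.Injective τ ∧ (∀ n, A (τ n) (t n) = w n) ∧
    (Pairwise fun n m => (P n).edges.Disjoint (P m).edges) ∧
    (∀ n m j, t m ≤ j → s(A (τ m) j, A (τ m) (j + 1)) ∉ (P n).edges) ∧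
    ∀ n, ∀ e ∈ (P n).edges, e ∈ E ∨ ∃ i, e ∈ rayEdges (A i)

lemma HasWalksToTails.of_comp {φ : ℕ → ℕ} (hφ : Function.Injective φ) {E : Set (Sym2 V)}
    (h : HasWalksToTails G (fun i => a (φ i)) A E) : HasWalksToTails G a A E := by
  obtain ⟨σ, τ, t, w, P, hσ, h⟩ := h
  exact ⟨fun n => φ (σ n), τ, t, w, P, hφ.comp hσ, h⟩

lemma hasWalksToTails_of_infinite_range {f q : ℕ → ℕ} {E : Set (Sym2 V)}
    (p : ∀ i, G.Walk (a i) (A (f i) (q i)))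
    (hp : Pairwise fun i j => (p i).edges.Disjoint (p j).edges)
    (hpA : ∀ i, ∀ e ∈ (p i).edges, e ∈ E ∧ ∀ j, e ∉ rayEdges (A j))
    (hf : (Set.range f).Infinite) : HasWalksToTails G a A E := by
  have hmem : ∀ n, ∃ i, f i = Nat.nth (· ∈ Set.range f) n := fun n =>
    Nat.nth_mem_of_infinite hf n
  choose σ hσ using hmem
  have hinj : Function.Injective fun n => f (σ n) := by
    intro m n h
    simp only [hσ] at h
    exact Nat.nth_injective hf h
  have hσi : Function.Injective σ := fun m n h => hinj (congrArg f h)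
  refine ⟨σ, fun n => f (σ n), fun n => q (σ n), _, fun n => p (σ n), hσi, hinj, fun _ => rfl,
    fun m n hmn => hp fun h => hmn (hσi h), fun n m j _ hj => ?_, fun n e he => ?_⟩
  · exact (hpA _ _ hj).2 _ ⟨j, rfl⟩
  · exact Or.inl (hpA _ e he).1

lemma hasWalksToTails_of_constant (hA : ∀ i, IsRay G (A i))
    (hAd : Pairwise fun i j => Disjoint (rayEdges (A i)) (rayEdges (A j)))
    (hmeet : ∀ i, {j | MeetsInf (A i) (A j)}.Infinite) {f q : ℕ → ℕ} {E : Set (Sym2 V)}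
    (p : ∀ i, G.Walk (a i) (A (f i) (q i)))
    (hp : Pairwise fun i j => (p i).edges.Disjoint (p j).edges)
    (hpA : ∀ i, ∀ e ∈ (p i).edges, e ∈ E ∧ ∀ j, e ∉ rayEdges (A j))
    {c : ℕ} (hc : {i | f i = c}.Infinite) (hq : ∀ M, {i | f i = c ∧ q i ≤ M}.Finite) :
    HasWalksToTails G a A E := by
  classical
  obtain ⟨y, hy, hyr⟩ := exists_seq_of_forall_finset_exists
    (fun y : ℕ × ℕ × ℕ × ℕ => f y.1 = c ∧ y.2.1 ≠ c ∧ q y.1 ≤ y.2.2.1 ∧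
      A c y.2.2.1 = A y.2.1 y.2.2.2)
    (fun x y => x.1 ≠ y.1 ∧ x.2.1 ≠ y.2.1 ∧ x.2.2.1 < q y.1) (by
      intro s _
      obtain ⟨i, hi, hi'⟩ := hc.exists_notMem_finite
        ((hq (s.sup fun x => x.2.2.1)).union (s.image Prod.fst).finite_toSet)
      obtain ⟨j, hj, hj'⟩ := (hmeet c).exists_notMem_finite
        (insert c (s.image fun x => x.2.1)).finite_toSet
      simp only [Set.mem_union, not_or, Finset.coe_image, Set.mem_image, not_exists] at hi'
      simp only [Finset.coe_insert, Set.mem_insert_iff, not_or, Finset.coe_image, Set.mem_image,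
        not_exists] at hj'
      obtain ⟨n, hn, n', -, hnn⟩ := hj (q i)
      refine ⟨(i, j, n, n'), ⟨hi, hj'.1, hn, hnn⟩, fun x hx => ⟨?_, ?_, ?_⟩⟩
      · exact fun h => hi'.2 x ⟨hx, h⟩
      · exact fun h => hj'.2 x ⟨hx, h⟩
      · have h1 : x.2.2.1 ≤ s.sup fun x => x.2.2.1 :=
          Finset.le_sup (f := fun x : ℕ × ℕ × ℕ × ℕ => x.2.2.1) hx
        have h2 := hi'.1
        simp only [Set.mem_ofPred_eq, not_and, not_le] at h2
        exact lt_of_le_of_lt h1 (h2 hi))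
  have hseg : ∀ n, ∃ w : G.Walk (A (f (y n).1) (q (y n).1)) (A (y n).2.1 (y n).2.2.2),
      ∀ e ∈ w.edges, ∃ l, q (y n).1 ≤ l ∧ l < (y n).2.2.1 ∧ e = s(A c l, A c (l + 1)) := by
    intro n
    obtain ⟨h1, -, h2, h3⟩ := hy n
    rw [h1, ← h3]
    exact exists_walk_segment (hA c).2 h2
  choose w hw using hseg
  have hmem : ∀ n, ∀ e ∈ ((p (y n).1).append (w n)).edges, e ∈ (p (y n).1).edges ∨
      ∃ l, q (y n).1 ≤ l ∧ l < (y n).2.2.1 ∧ e = s(A c l, A c (l + 1)) := by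
    intro n e he
    rw [Walk.edges_append, List.mem_append] at he
    exact he.imp_right (hw n e)
  have hlt : ∀ m n, m < n →
      ((p (y m).1).append (w m)).edges.Disjoint ((p (y n).1).append (w n)).edges := by
    intro m n hmn e he he'
    obtain ⟨h1, -, h2⟩ := hyr m n hmn
    rcases hmem m e he with he | ⟨l, hl, hl', he⟩ <;>
      rcases hmem n e he' with he' | ⟨l', hl'', hl''', he'⟩
    · exact hp h1 he he'
    · exact (hpA _ e he).2 c ⟨l', he'⟩
    · exact (hpA _ e he').2 c ⟨l, he⟩
    · have := (hA c).edge_inj (he.symm.trans he')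
      omega
  have hne : ∀ m n, m ≠ n → (y m).1 ≠ (y n).1 ∧ (y m).2.1 ≠ (y n).2.1 := by
    intro m n hmn
    rcases lt_or_gt_of_ne hmn with h | h
    · exact ⟨(hyr m n h).1, (hyr m n h).2.1⟩
    · exact ⟨(hyr n m h).1.symm, (hyr n m h).2.1.symm⟩
  refine ⟨fun n => (y n).1, fun n => (y n).2.1, fun n => (y n).2.2.2, _,
    fun n => (p (y n).1).append (w n), ?_, ?_, fun _ => rfl, ?_, ?_, ?_⟩
  · intro m n h
    by_contra hmn
    exact (hne m n hmn).1 h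
  · intro m n h
    by_contra hmn
    exact (hne m n hmn).2 h
  · intro m n hmn
    rcases lt_or_gt_of_ne hmn with h | h
    exacts [hlt m n h, (hlt n m h).symm]
  · intro n m j _ hj
    rcases hmem n _ hj with h | ⟨l, -, -, h⟩
    · exact (hpA _ _ h).2 _ ⟨j, rfl⟩
    · exact Set.disjoint_left.1 (hAd (hy m).2.1) ⟨j, rfl⟩ ⟨l, h⟩
  · intro n e he
    rcases hmem n e he with h | ⟨l, -, -, h⟩
    · exact Or.inl (hpA _ _ h).1
    · exact Or.inr ⟨c, l, h⟩

lemma hasWalksToTails {v : V} (hA : ∀ i, IsRay G (A i) ∧ A i 0 = v)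
    (hAd : Pairwise fun i j => Disjoint (rayEdges (A i)) (rayEdges (A j)))
    (hmeet : ∀ i, {j | MeetsInf (A i) (A j)}.Infinite) {E : Set (Sym2 V)} (D : ∀ i, G.Walk (a i) v)
    (hD : Pairwise fun i j => (D i).edges.Disjoint (D j).edges)
    (hDE : ∀ i, ∀ e ∈ (D i).edges, e ∈ E) : HasWalksToTails G a A E := by
  classical
  set EA : Set (Sym2 V) := ⋃ i, rayEdges (A i) with hEA
  have hnotEA : ∀ e, e ∉ EA → ∀ j, e ∉ rayEdges (A j) := fun e he j hj =>
    he (Set.mem_iUnion.2 ⟨j, hj⟩)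
  set I : Set ℕ := {i | ∀ e ∈ (D i).edges, e ∉ EA} with hI
  by_cases hfin : I.Infinite
  · have hinj := Nat.nth_injective hfin
    refine ⟨Nat.nth (· ∈ I), id, fun _ => 0, fun _ => v, fun n => D (Nat.nth (· ∈ I) n), hinj,
      Function.injective_id, fun n => (hA n).2, fun m n hmn => hD fun h => hmn (hinj h), ?_,
      fun n e he => Or.inl (hDE _ e he)⟩
    intro n m j _ hj
    exact hnotEA _ ((Nat.nth_mem_of_infinite hfin n : Nat.nth (· ∈ I) n ∈ I) _ hj) m ⟨j, rfl⟩
  · have hinf : Iᶜ.Infinite := (Set.not_infinite.1 hfin).infinite_compl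
    have hφ := Nat.nth_injective (p := (· ∈ Iᶜ)) hinf
    have hφmem : ∀ n, Nat.nth (· ∈ Iᶜ) n ∉ I := fun n =>
      Nat.nth_mem_of_infinite (p := (· ∈ Iᶜ)) hinf n
    generalize Nat.nth (· ∈ Iᶜ) = φ at hφ hφmem
    refine HasWalksToTails.of_comp hφ ?_
    have h1 : ∀ n, ∃ (f q r : ℕ) (p : G.Walk (a (φ n)) (A f q)), p.edges ⊆ (D (φ n)).edges ∧
        (∀ e ∈ p.edges, e ∉ EA) ∧ r ≤ q ∧ s(A f r, A f (r + 1)) ∈ (D (φ n)).edges := by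
      intro n
      rcases exists_initial_walk EA (D (φ n)) with h | ⟨z, p, hp, hpE, e, he, heD, hz⟩
      · exact absurd h (hφmem n)
      · obtain ⟨f, r, rfl⟩ := Set.mem_iUnion.1 he
        rcases Sym2.mem_iff.1 hz with rfl | rfl
        · exact ⟨f, r, r, p, hp, hpE, le_rfl, heD⟩
        · exact ⟨f, r + 1, r, p, hp, hpE, Nat.le_succ r, heD⟩
    choose f q r p hp hpE hrq hr using h1
    have hpd : Pairwise fun i j => (p i).edges.Disjoint (p j).edges := fun i j hij e he he' =>
      hD (fun h => hij (hφ h)) (hp i he) (hp j he')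
    have hpA : ∀ i, ∀ e ∈ (p i).edges, e ∈ E ∧ ∀ j, e ∉ rayEdges (A j) := fun i e he =>
      ⟨hDE _ e (hp i he), hnotEA e (hpE i e he)⟩
    by_cases hrange : (Set.range f).Infinite
    · exact hasWalksToTails_of_infinite_range p hpd hpA hrange
    · obtain ⟨c, hc⟩ : ∃ c, {i | f i = c}.Infinite := by
        by_contra! hcon
        refine Set.infinite_univ (α := ℕ) (((Set.not_infinite.1 hrange).biUnion fun c _ =>
          hcon c).subset fun i _ => ?_)
        exact Set.mem_biUnion ⟨i, rfl⟩ rfl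
      refine hasWalksToTails_of_constant (fun i => (hA i).1) hAd hmeet p hpd hpA hc fun M => ?_
      refine Set.Finite.of_finite_image (f := r) ((Set.finite_Iic M).subset ?_) ?_
      · rintro _ ⟨i, ⟨-, hi⟩, rfl⟩
        exact (hrq i).trans hi
      · rintro i ⟨hi, -⟩ j ⟨hj, -⟩ hij
        by_contra hne
        have h1 := hr i
        have h2 := hr j
        rw [hi, hij] at h1
        rw [hj] at h2
        exact hD (fun h => hne (hφ h)) h1 h2

end Tails

lemma exists_ray_of_walk {G : SimpleGraph V} {u v : V} (w : G.Walk u v) {β : ℕ → V}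
    (hβ : IsRay G β) (hβ0 : β 0 = v) : ∃ γ, IsRay G γ ∧ γ 0 = u ∧
      (∀ e ∈ rayEdges γ, e ∈ w.edges ∨ e ∈ rayEdges β) ∧ ∃ a b, ∀ n, β (a + n) = γ (b + n) := by
  induction w with
  | nil => exact ⟨β, hβ, hβ0, fun _ => Or.inr, 0, 0, fun _ => rfl⟩
  | @cons u v' _ h w ih =>
    obtain ⟨γ, hγ, hγ0, hγe, a, b, hab⟩ := ih hβ0
    have hmono : ∀ e ∈ rayEdges γ, e ∈ (Walk.cons h w).edges ∨ e ∈ rayEdges β := fun e he =>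
      (hγe e he).imp_left fun h' => by
        rw [Walk.edges_cons]
        exact List.mem_cons_of_mem _ h'
    by_cases hu : ∃ i, γ i = u
    · obtain ⟨i, hi⟩ := hu
      refine ⟨fun n => γ (i + n), hγ.tail i, hi, fun e he => hmono e (rayEdges_tail_subset γ i he),
        a + i, b, fun n => ?_⟩
      rw [add_assoc, hab]
      congr 1
      omega
    · push Not at hu
      refine ⟨fun n => Nat.casesOn n u γ, ⟨?_, ?_⟩, rfl, ?_, a, b + 1, fun n => ?_⟩
      · rintro (_ | i) (_ | j) hij
        · rfl
        · exact absurd hij.symm (hu j)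
        · exact absurd hij (hu i)
        · exact congrArg _ (hγ.1 hij)
      · rintro (_ | n)
        · change G.Adj u (γ 0)
          rwa [hγ0]
        · exact hγ.2 n
      · rintro e ⟨_ | n, rfl⟩
        · left
          change s(u, γ 0) ∈ _
          rw [hγ0, Walk.edges_cons]
          exact List.mem_cons_self
        · exact hmono _ ⟨n, rfl⟩
      · rw [hab, show b + 1 + n = b + n + 1 by omega]

/-- Two inequivalent rays with the same starting vertex contain a double ray joining their ends. -/
lemma exists_doubleRay {G : SimpleGraph V} {α γ : ℕ → V} (hα : IsRay G α) (hγ : IsRay G γ)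
    (h0 : α 0 = γ 0) (hne : ¬ RayEquiv G α γ) : ∃ g : ℤ → V, IsDoubleRay G g ∧
      drEdges g ⊆ rayEdges α ∪ rayEdges γ ∧ RayEquiv G α (drBwd g) ∧ RayEquiv G γ (drFwd g) := by
  have hfin : {m | α m ∈ Set.range γ}.Finite := by
    have : ∃ N, ∀ i ≥ N, ∀ j ≥ N, α i ≠ γ j := by
      by_contra! hcon
      exact hne (rayEquiv_of_frequently_meet hα hγ hcon)
    obtain ⟨N, hN⟩ := this
    refine ((Set.finite_Iio N).union (((Set.finite_Iio N).image γ).preimage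
      hα.1.injOn)).subset ?_
    rintro m ⟨j, hj⟩
    by_contra hcon
    simp only [Set.mem_union, Set.mem_Iio, Set.mem_preimage, Set.mem_image, not_or, not_lt,
      not_exists, not_and] at hcon
    exact hN m hcon.1 j (not_lt.1 fun h => hcon.2 j h hj) hj.symm
  obtain ⟨m, ⟨l, hl⟩, hmax⟩ := Set.exists_max_image _ id hfin ⟨0, 0, h0.symm⟩
  have hnot : ∀ k j, α (m + (k + 1)) ≠ γ j := fun k j h => by
    have := hmax (m + (k + 1)) ⟨j, h.symm⟩
    simp only [id] at this
    omega
  let g : ℤ → V := fun n => if 0 ≤ n then γ (l + n.toNat) else α (m + (-n).toNat)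
  have hg1 : ∀ k : ℕ, g k = γ (l + k) := fun k => by simp [g]
  have hg2 : ∀ k : ℕ, g (-k) = α (m + k) := by
    rintro (_ | k)
    · simp [g, hl]
    · simp only [g]
      rw [if_neg (by omega)]
      simp
  have hcases : ∀ n : ℤ, (∃ k : ℕ, n = k) ∨ ∃ k : ℕ, n = -((k + 1 : ℕ) : ℤ) := by
    intro n
    rcases le_or_gt 0 n with h | h
    · exact Or.inl (Int.eq_ofNat_of_zero_le h)
    · exact Or.inr ⟨(-n - 1).toNat, by omega⟩
  have hstep : ∀ k : ℕ, g (-((k + 1 : ℕ) : ℤ) + 1) = α (m + k) := fun k => by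
    rw [← hg2]
    congr 1
    push_cast
    ring
  have hg : IsDoubleRay G g := by
    refine ⟨fun i j hij => ?_, fun n => ?_⟩
    · rcases hcases i with ⟨i, rfl⟩ | ⟨i, rfl⟩ <;> rcases hcases j with ⟨j, rfl⟩ | ⟨j, rfl⟩
      · rw [hg1, hg1] at hij
        have := hγ.1 hij
        omega
      · rw [hg1, hg2] at hij
        exact absurd hij.symm (hnot _ _)
      · rw [hg1, hg2] at hij
        exact absurd hij (hnot _ _)
      · rw [hg2, hg2] at hij
        have := hα.1 hij
        omega
    · rcases hcases n with ⟨k, rfl⟩ | ⟨k, rfl⟩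
      · have := hg1 (k + 1)
        push_cast at this
        rw [hg1, this]
        exact hγ.2 _
      · rw [hg2, hstep]
        exact (hα.2 _).symm
  refine ⟨g, hg, ?_, ?_, ?_⟩
  · rintro e ⟨n, rfl⟩
    rcases hcases n with ⟨k, rfl⟩ | ⟨k, rfl⟩
    · have := hg1 (k + 1)
      push_cast at this
      rw [hg1, this]
      exact Or.inr ⟨l + k, rfl⟩
    · rw [hg2, hstep, Sym2.eq_swap]
      exact Or.inl ⟨m + k, rfl⟩
  · refine rayEquiv_of_common_tail hα (drBwd_isRay hg) (a := m + 1) (b := 0) fun n => ?_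
    have := hg2 (1 + n)
    rw [add_assoc, ← this, drBwd]
    congr 1
    push_cast
    ring
  · refine rayEquiv_of_common_tail hγ (drFwd_isRay hg) (a := l) (b := 0) fun n => ?_
    rw [← hg1, drFwd]
    simp

lemma rayEdges_subset_edgeSet {K : SimpleGraph V} {f : ℕ → V} (hf : IsRay K f) :
    rayEdges f ⊆ K.edgeSet := by
  rintro e ⟨n, rfl⟩
  exact hf.2 n

lemma disjoint_edgeSet_touching {G : SimpleGraph V} {S : Set V} {W₁ W₂ : ℕ → V}
    (hC : Disjoint (endComp G S W₁) (endComp G S W₂)) :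
    Disjoint (touching G (endComp G S W₁)).edgeSet (touching G (endComp G S W₂)).edgeSet := by
  rw [Set.disjoint_left] at hC ⊢
  intro e he he'
  induction e with
  | _ u v =>
    rw [mem_edgeSet] at he he'
    rcases he.2 with h | h <;> rcases he'.2 with hv | hv
    · exact hC h hv
    · exact hC (mem_endComp_of_adj h he.1 (notMem_of_mem_endComp hv)) hv
    · exact hC (mem_endComp_of_adj h he.1.symm (notMem_of_mem_endComp hv)) hv
    · exact hC h hv

/-- In the situation of a separated thin end `W₁`, the edge-disjoint rays at a common vertex
obtained in a neighbourhood of the end. -/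
lemma exists_meeting_rays {G : SimpleGraph V} {S : Set V} (hS : S.Finite) {W₁ W₂ : ℕ → V}
    (h₁ : IsRay G W₁) {k : ℕ} (hdeg : EndVertexDegree G W₁ k)
    (hsep : ∀ f, IsRay G f → ∀ b, (∀ j, b ≤ j → f j ∉ S) → f b ∈ endComp G S W₁ →
      RayEquiv G W₁ f)
    (hC : Disjoint (endComp G S W₁) (endComp G S W₂))
    (h : ∀ k : ℕ, ∃ F : Fin k → ℤ → V, (∀ i, IsDoubleRay G (F i) ∧ ConvBoth G W₁ W₂ (F i)) ∧
      Pairwise fun i j => Disjoint (drEdges (F i)) (drEdges (F j))) :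
    ∃ (x : V) (A : ℕ → ℕ → V), (∀ i, IsRay G (A i) ∧ A i 0 = x ∧ RayEquiv G W₁ (A i)) ∧
      (∀ i, rayEdges (A i) ⊆ (touching G (endComp G S W₁)).edgeSet) ∧
      (Pairwise fun i j => Disjoint (rayEdges (A i)) (rayEdges (A j))) ∧
      ∀ i, {j | MeetsInf (A i) (A j)}.Infinite := by
  obtain ⟨x₀, hx₀⟩ := exists_fan_touching hS hC h
  obtain ⟨x, A, hA, hAd⟩ := exists_rays_of_fan (rayEquiv_touching h₁ hS hsep) hx₀
  have hAG : ∀ i, IsRay G (A i) := fun i => (hA i).1.mono (touching_le _ _)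
  have hAW : ∀ i, RayEquiv G W₁ (A i) := fun i => rayEquiv_of_isRay_touching hS hsep (hA i).1
  obtain ⟨φ, hφ, hmeet⟩ := hdeg.exists_subfamily fun i => ⟨hAG i, hAW i⟩
  exact ⟨x, fun i => A (φ i), fun i => ⟨hAG _, (hA _).2, hAW _⟩,
    fun i => rayEdges_subset_edgeSet (hA _).1, fun i j hij => hAd fun h => hij (hφ h), hmeet⟩

/-- In a graph with finitely many ends, all thin, if two distinct ends `ω₁, ω₂` are
joined by arbitrarily many pairwise edge-disjoint double rays, then they are joined
by infinitely many. -/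
theorem stmt_14 (G : SimpleGraph V)
    (N : ℕ) (E : Fin N → ℕ → V) (hE : ∀ i, IsRay G (E i))
    (hall : ∀ f : ℕ → V, IsRay G f → ∃ i, RayEquiv G (E i) f)
    (hthin : ∀ f : ℕ → V, IsRay G f → ∃ k, EndVertexDegree G f k)
    (W₁ W₂ : ℕ → V) (h₁ : IsRay G W₁) (h₂ : IsRay G W₂)
    (hne : ¬ RayEquiv G W₁ W₂)
    (h : ∀ k : ℕ, ∃ F : Fin k → ℤ → V,
      (∀ i, IsDoubleRay G (F i) ∧ ConvBoth G W₁ W₂ (F i)) ∧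
      Pairwise fun i j => Disjoint (drEdges (F i)) (drEdges (F j))) :
    ∃ F : ℕ → ℤ → V, (∀ i, IsDoubleRay G (F i) ∧ ConvBoth G W₁ W₂ (F i)) ∧
      Pairwise fun i j => Disjoint (drEdges (F i)) (drEdges (F j)) := by
  obtain ⟨S₁, hS₁, hsep₁⟩ := exists_separator hE hall W₁
  obtain ⟨S₂, hS₂, hsep₂⟩ := exists_separator hE hall W₂
  have hS := hS₁.union hS₂
  replace hsep₁ := hsep₁ _ Set.subset_union_left hS
  replace hsep₂ := hsep₂ _ Set.subset_union_right hS
  generalize S₁ ∪ S₂ = S at hS hsep₁ hsep₂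
  have hC : Disjoint (endComp G S W₁) (endComp G S W₂) := by
    rw [Set.disjoint_left]
    rintro v hv ⟨a, ha, hr⟩
    exact hne (hsep₁ W₂ h₂ a ha (mem_endComp_of_reachable hv hr.symm))
  obtain ⟨k₁, hk₁⟩ := hthin W₁ h₁
  obtain ⟨k₂, hk₂⟩ := hthin W₂ h₂
  obtain ⟨x₁, A, hA, hAK, hAd, hAm⟩ := exists_meeting_rays hS h₁ hk₁ hsep₁ hC h
  obtain ⟨x₂, B, hB, hBK, hBd, hBm⟩ := exists_meeting_rays hS h₂ hk₂ hsep₂ hC.symm fun k =>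
    (h k).imp fun F hF => ⟨fun i => ⟨(hF.1 i).1, (hF.1 i).2.symm⟩, hF.2⟩
  have hAB : ∀ i j e, e ∈ rayEdges (A i) → e ∉ rayEdges (B j) := fun i j e he he' =>
    Set.disjoint_left.1 (disjoint_edgeSet_touching hC) (hAK i he) (hBK j he')
  obtain ⟨D, hD⟩ := exists_disjoint_walks h h₁ h₂ hA hAd hB hBd
  obtain ⟨σ, τ, t, w, P, -, hτ, hw, hP, hPA, -⟩ := hasWalksToTails (E := Set.univ)
    (fun i => ⟨(hA i).1, (hA i).2.1⟩) hAd hAm D hD fun _ _ _ => trivial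
  obtain ⟨σ', τ', t', w', Q, hσ', hτ', hw', hQ, hQB, hQE⟩ := hasWalksToTails (a := w)
    (E := {e | ∃ n, e ∈ (P n).edges}) (fun i => ⟨(hB i).1, (hB i).2.1⟩) hBd hBm
    (fun n => (P n).reverse)
    (fun i j hij e he he' => hP hij (by simpa using he) (by simpa using he'))
    (fun i e he => ⟨i, by simpa using he⟩)
  have hglue : ∀ n, ∃ g : ℤ → V, (IsDoubleRay G g ∧ ConvBoth G W₁ W₂ g) ∧ ∀ e ∈ drEdges g,
      (∃ j, t (σ' n) ≤ j ∧ e = s(A (τ (σ' n)) j, A (τ (σ' n)) (j + 1))) ∨ e ∈ (Q n).edges ∨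
      ∃ j, t' n ≤ j ∧ e = s(B (τ' n) j, B (τ' n) (j + 1)) := by
    intro n
    obtain ⟨hAr, -, hAW⟩ := hA (τ (σ' n))
    obtain ⟨hBr, -, hBW⟩ := hB (τ' n)
    have hα := hAr.tail (t (σ' n))
    have hβ := hBr.tail (t' n)
    obtain ⟨γ, hγ, hγ0, hγe, a, b, hab⟩ := exists_ray_of_walk (Q n) hβ (hw' n)
    have hαW : RayEquiv G W₁ fun i => A (τ (σ' n)) (t (σ' n) + i) :=
      hAW.trans hAr.2 (rayEquiv_of_common_tail hAr hα (a := t (σ' n)) (b := 0)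
        fun i => by rw [zero_add])
    have hγW : RayEquiv G W₂ γ :=
      (hBW.trans hBr.2 (rayEquiv_of_common_tail hBr hβ (a := t' n) (b := 0)
        fun i => by rw [zero_add])).trans
        hβ.2 (rayEquiv_of_common_tail hβ hγ hab)
    obtain ⟨g, hg, hge, hg₁, hg₂⟩ := exists_doubleRay hα hγ ((hw _).trans hγ0.symm) fun hαγ =>
      hne ((hαW.trans hα.2 hαγ).trans hγ.2 hγW.symm)
    refine ⟨g, ⟨hg, Or.inr ⟨hαW.trans hα.2 hg₁, hγW.trans hγ.2 hg₂⟩⟩, fun e he => ?_⟩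
    rcases hge he with ⟨i, rfl⟩ | he
    · exact Or.inl ⟨_, Nat.le_add_right _ i, rfl⟩
    · rcases hγe e he with he | ⟨i, rfl⟩
      · exact Or.inr (Or.inl he)
      · exact Or.inr (Or.inr ⟨_, Nat.le_add_right _ i, rfl⟩)
  choose g hg hge using hglue
  have hAQ : ∀ m n j, t m ≤ j → s(A (τ m) j, A (τ m) (j + 1)) ∉ (Q n).edges := by
    intro m n j hj he
    rcases hQE n _ he with ⟨i, hi⟩ | ⟨i, hi⟩
    · exact hPA i m j hj hi
    · exact hAB _ i _ ⟨j, rfl⟩ hi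
  refine ⟨g, hg, fun n m hnm => Set.disjoint_left.2 fun e he he' => ?_⟩
  rcases hge n e he with ⟨j, hj, rfl⟩ | hen | ⟨j, hj, rfl⟩ <;>
    rcases hge m _ he' with ⟨j', hj', h'⟩ | hem | ⟨j', hj', h'⟩
  · exact Set.disjoint_left.1 (hAd fun h => hnm (hσ' (hτ h))) ⟨j, rfl⟩ ⟨j', h'⟩
  · exact hAQ _ _ _ hj hem
  · exact hAB _ _ _ ⟨j, rfl⟩ ⟨j', h'⟩
  · exact hAQ _ _ _ hj' (h' ▸ hen)
  · exact hQ hnm hen hem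
  · exact hQB _ _ _ hj' (h' ▸ hen)
  · exact hAB _ _ _ ⟨j', h'⟩ ⟨j, rfl⟩
  · exact hQB _ _ _ hj hem
  · exact Set.disjoint_left.1 (hBd fun h => hnm (hτ' h)) ⟨j, rfl⟩ ⟨j', h'⟩
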